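/- arXiv:1909.03426 — 10 statements merged into one kernel-verified Lean document; each statement's English description precedes it below -/
import Mathlib

section
/- Let C be a k-dimensional Reed–Solomon code of length n over F_q with 2 ≤ k < n, and let d denote its minimum insdel distance. If q ≥ n², then d ≤ 2n − 2k. Consequently such codes can correct at most n − k − 1 insdel errors. -/
/-- `b` is obtained from `a` by a single symbol insertion or deletion. -/
def InsDelStep {α : Type*} (a b : List α) : Prop :=
  (∃ (l r : List α) (x : α), a = l ++ x :: r ∧ b = l ++ r) ∨
  (∃ (l r : List α) (x : α), b = l ++ x :: r ∧ a = l ++ r)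

/-- The insdel distance: the minimum number of single-symbol insertions and
deletions needed to transform `a` into `b`. -/
noncomputable def insdelDist {α : Type*} (a b : List α) : ℕ :=
  sInf {m : ℕ | ∃ c : ℕ → List α, c 0 = a ∧ c m = b ∧ ∀ i < m, InsDelStep (c i) (c (i + 1))}

/-- The minimum insdel distance of a code `C ⊆ F^n`. -/
noncomputable def codeInsdelDist {F : Type*} {n : ℕ} (C : Set (Fin n → F)) : ℕ :=
  sInf {m : ℕ | ∃ c1 ∈ C, ∃ c2 ∈ C, c1 ≠ c2 ∧ m = insdelDist (List.ofFn c1) (List.ofFn c2)}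

/-- The Reed–Solomon code of dimension `k` with evaluation points `α 0, …, α (n-1)`. -/
def RSCode (F : Type*) [Field F] {n : ℕ} (k : ℕ) (α : Fin n → F) : Set (Fin n → F) :=
  {c | ∃ f : Polynomial F, f.degree < (k : WithBot ℕ) ∧ c = fun i => Polynomial.eval (α i) f}

theorem InsDelStep.symm {α : Type*} {a b : List α} (h : InsDelStep a b) : InsDelStep b a :=
  Or.symm h

theorem InsDelStep.cons {α : Type*} {a b : List α} (x : α) (h : InsDelStep a b) :
    InsDelStep (x :: a) (x :: b) := by
  rcases h with ⟨l, r, y, rfl, rfl⟩ | ⟨l, r, y, rfl, rfl⟩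
  · exact Or.inl ⟨x :: l, r, y, rfl, rfl⟩
  · exact Or.inr ⟨x :: l, r, y, rfl, rfl⟩

/-- `b` is reached from `a` by exactly `m` insertions and deletions. -/
def InsDelReach {α : Type*} (m : ℕ) (a b : List α) : Prop :=
  ∃ c : ℕ → List α, c 0 = a ∧ c m = b ∧ ∀ i < m, InsDelStep (c i) (c (i + 1))

namespace InsDelReach

variable {α : Type*} {a b d : List α} {m p : ℕ}

theorem refl (a : List α) : InsDelReach 0 a a :=
  ⟨fun _ => a, rfl, rfl, by simp⟩

theorem head (h : InsDelStep a b) (hr : InsDelReach m b d) : InsDelReach (m + 1) a d := by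
  obtain ⟨c, h0, hm, hs⟩ := hr
  refine ⟨fun i => Nat.casesOn i a c, rfl, hm, ?_⟩
  rintro (_ | i) hi
  · simpa [h0] using h
  · exact hs i (by omega)

theorem trans (hab : InsDelReach m a b) (hbd : InsDelReach p b d) :
    InsDelReach (m + p) a d := by
  induction m generalizing a with
  | zero =>
    obtain ⟨c, rfl, rfl, -⟩ := hab
    simpa using hbd
  | succ m ih =>
    obtain ⟨c, rfl, hm, hs⟩ := hab
    have h := ih (a := c 1) ⟨fun i => c (i + 1), rfl, hm, fun i hi => hs (i + 1) (by omega)⟩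
    simpa [Nat.add_right_comm] using head (hs 0 (by omega)) h

theorem symm (h : InsDelReach m a b) : InsDelReach m b a := by
  obtain ⟨c, rfl, rfl, hs⟩ := h
  refine ⟨fun i => c (m - i), rfl, by simp, fun i hi => ?_⟩
  have := (hs (m - (i + 1)) (by omega)).symm
  rwa [show m - (i + 1) + 1 = m - i by omega] at this

theorem cons (x : α) (h : InsDelReach m a b) : InsDelReach m (x :: a) (x :: b) := by
  obtain ⟨c, rfl, rfl, hs⟩ := h
  exact ⟨fun i => x :: c i, rfl, rfl, fun i hi => (hs i hi).cons x⟩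

theorem of_sublist (h : b.Sublist a) : InsDelReach (a.length - b.length) a b := by
  induction h with
  | slnil => exact refl []
  | @cons l₁ l₂ x h ih =>
    have hl := h.length_le
    rw [List.length_cons, show l₂.length + 1 - l₁.length = l₂.length - l₁.length + 1 by omega]
    exact head (Or.inl ⟨[], l₂, x, rfl, rfl⟩) ih
  | cons_cons x h ih => simpa using ih.cons x

theorem insdelDist_le (h : InsDelReach m a b) : insdelDist a b ≤ m :=
  Nat.sInf_le h

end InsDelReach

theorem insdelDist_le_of_sublist {α : Type*} {a w : List α} (h : w.Sublist a) :
    insdelDist a w ≤ a.length - w.length :=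
  (InsDelReach.of_sublist h).insdelDist_le

theorem insdelDist_le_of_common_sublist {α : Type*} {a b w : List α}
    (ha : w.Sublist a) (hb : w.Sublist b) :
    insdelDist a b ≤ (a.length - w.length) + (b.length - w.length) :=
  ((InsDelReach.of_sublist ha).trans (InsDelReach.of_sublist hb).symm).insdelDist_le

/-- The codeword of `X` and the codeword of the polynomial of degree `< k` taking `α (i + 1)` to
`α i` for all `i < k` are distinct and share a subsequence of length `k`. -/
theorem RSCode.exists_common_sublist {F : Type*} [Field F] {n k : ℕ} (hk : 2 ≤ k) (hkn : k < n)
    (α : Fin n → F) (hα : Function.Injective α) :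
    ∃ c1 ∈ RSCode F k α, ∃ c2 ∈ RSCode F k α, c1 ≠ c2 ∧ ∃ w : List F,
      w.length = k ∧ w.Sublist (List.ofFn c1) ∧ w.Sublist (List.ofFn c2) := by
  let v : Fin k → F := fun i => α ⟨i + 1, by omega⟩
  let r : Fin k → F := fun i => α ⟨i, by omega⟩
  have hv : Function.Injective v := fun i j h => by
    have := congrArg Fin.val (hα h)
    exact Fin.ext (by simpa using this)
  let g := Lagrange.interpolate Finset.univ v r
  have hg : ∀ i : Fin k, g.eval (v i) = r i := fun i =>
    Lagrange.eval_interpolate_at_node r hv.injOn (Finset.mem_univ i)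
  have hdeg : g.degree < (k : WithBot ℕ) := by
    simpa only [Finset.card_univ, Fintype.card_fin] using
      Lagrange.degree_interpolate_lt (s := Finset.univ) r hv.injOn
  refine ⟨α, ⟨Polynomial.X, ?_, by simp⟩, _, ⟨g, hdeg, rfl⟩, ?_, (List.ofFn α).take k, ?_, ?_, ?_⟩
  · rw [Polynomial.degree_X]
    exact_mod_cast hk
  · intro h
    have h1 : v ⟨0, by omega⟩ = r ⟨0, by omega⟩ :=
      (congrFun h ⟨0 + 1, by omega⟩).trans (hg ⟨0, by omega⟩)
    simpa using congrArg Fin.val (hα h1)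
  · simp [hkn.le]
  · exact List.take_sublist _ _
  · have hw : (List.ofFn α).take k =
        ((List.ofFn fun i => g.eval (α i)).drop 1).take k := by
      refine List.ext_getElem (by simp; omega) fun i hi _ => ?_
      have hik : i < k := by simp at hi; omega
      simpa [Nat.add_comm 1 i] using (hg ⟨i, hik⟩).symm
    rw [hw]
    exact (List.take_sublist _ _).trans (List.drop_sublist _ _)

/-- a `k`-dimensional Reed–Solomon code of length `n` over `F_q` with
`2 ≤ k < n` and `q ≥ n²` has minimum insdel distance `d ≤ 2n - 2k`; consequently such a
code can correct at most `n - k - 1` insdel errors. -/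
theorem rs_insdel_distance_improved_bound
    {F : Type*} [Field F] [Fintype F] {q n k : ℕ} (hq : Fintype.card F = q)
    (hk : 2 ≤ k) (hkn : k < n) (hnq : n ≤ q)
    (α : Fin n → F) (hα : Function.Injective α)
    (hqn : n ^ 2 ≤ q) :
    codeInsdelDist (RSCode F k α) ≤ 2 * n - 2 * k ∧
    ∀ t : ℕ,
      (∀ v : List F, ∀ c1 ∈ RSCode F k α, ∀ c2 ∈ RSCode F k α,
        insdelDist (List.ofFn c1) v ≤ t → insdelDist (List.ofFn c2) v ≤ t → c1 = c2) →
      t ≤ n - k - 1 := by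
  obtain ⟨c1, h1, c2, h2, hne, w, hw, hw1, hw2⟩ := RSCode.exists_common_sublist hk hkn α hα
  constructor
  · have hd : codeInsdelDist (RSCode F k α) ≤ insdelDist (List.ofFn c1) (List.ofFn c2) :=
      Nat.sInf_le ⟨c1, h1, c2, h2, hne, rfl⟩
    have h := insdelDist_le_of_common_sublist hw1 hw2
    simp only [List.length_ofFn, hw] at h
    omega
  · intro t ht
    by_contra hlt
    have d1 := insdelDist_le_of_sublist hw1
    have d2 := insdelDist_le_of_sublist hw2
    simp only [List.length_ofFn, hw] at d1 d2
    exact hne (ht w c1 h1 c2 h2 (by omega) (by omega))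
end

section
/- Let F_q be a finite field, let 2 ≤ k < n ≤ q, and let α_1, …, α_n be distinct elements of F_q. Then the number of polynomials f ∈ F_q[x] with deg f < k such that the values f(α_1), …, f(α_n) are pairwise distinct is at least q^{k−1} · (q − n(n−1)/2). -/
open Polynomial in
/-- In the space of polynomials of degree `< k`, those taking the same value at two given distinct
points form a hyperplane. -/
theorem card_degreeLT_eval_eq {F : Type*} [Field F] [Fintype F] {k : ℕ} (hk : 2 ≤ k)
    {a b : F} (hab : a ≠ b) :
    Nat.card {f : degreeLT F k // f.1.eval a = f.1.eval b} = Fintype.card F ^ (k - 1) := by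
  let L : degreeLT F k →ₗ[F] F := (leval a - leval b).comp (degreeLT F k).subtype
  have hfin : Module.finrank F (degreeLT F k) = k := by
    rw [(degreeLTEquiv F k).finrank_eq, Module.finrank_fin_fun]
  have hfd : Module.Finite F (degreeLT F k) := Module.Finite.equiv (degreeLTEquiv F k).symm
  have hL : L ≠ 0 := by
    intro h
    have hX : (X : F[X]) ∈ degreeLT F k := by
      rw [mem_degreeLT, degree_X]
      exact_mod_cast hk
    have h0 := LinearMap.congr_fun h ⟨X, hX⟩
    simp [L, leval, sub_eq_zero] at h0
    exact hab h0
  have hrank := Module.Dual.finrank_ker_add_one_of_ne_zero (f := L) hL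
  have hker : Module.finrank F (LinearMap.ker L) = k - 1 := by omega
  rw [← hker, ← Nat.card_eq_fintype_card, ← Module.natCard_eq_pow_finrank (K := F) (V := LinearMap.ker L)]
  refine Nat.card_congr (Equiv.subtypeEquivRight fun f => ?_)
  simp [L, leval, sub_eq_zero]

/-- for a finite field `F_q`, `2 ≤ k < n ≤ q` and distinct evaluation points
`α 0, …, α (n-1)`, the number of polynomials `f` of degree `< k` such that the values
`f(α 0), …, f(α (n-1))` are pairwise distinct is at least `q^(k-1) · (q - n(n-1)/2)`. -/
theorem count_injective_evaluation_polynomials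
    {F : Type*} [Field F] [Fintype F] {q n k : ℕ} (hq : Fintype.card F = q)
    (hk : 2 ≤ k) (hkn : k < n) (hnq : n ≤ q)
    (α : Fin n → F) (hα : Function.Injective α) :
    (q : ℤ) ^ (k - 1) * ((q : ℤ) - (n : ℤ) * ((n : ℤ) - 1) / 2) ≤
      ({f : Polynomial F | f.degree < (k : WithBot ℕ) ∧
          Function.Injective fun i => Polynomial.eval (α i) f}).ncard := by
  classical
  have : Finite (Polynomial.degreeLT F k) :=
    Finite.of_equiv _ (Polynomial.degreeLTEquiv F k).toEquiv.symm
  have := Fintype.ofFinite (Polynomial.degreeLT F k)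
  set good : Finset (Polynomial.degreeLT F k) :=
    {f | Function.Injective fun i => f.1.eval (α i)} with hgood
  let collide (p : (_ : Fin n) × Fin n) : Finset (Polynomial.degreeLT F k) :=
    {f | f.1.eval (α p.1) = f.1.eval (α p.2)}
  let pairs : Finset ((_ : Fin n) × Fin n) := Finset.univ.sigma fun i => Finset.Iio i
  have hncard : {f : Polynomial F | f.degree < (k : WithBot ℕ) ∧
      Function.Injective fun i => f.eval (α i)}.ncard = good.card := by
    rw [← Set.ncard_coe_finset, ← Set.ncard_image_of_injective _ Subtype.val_injective]
    congr 1
    ext f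
    simp [hgood, Polynomial.mem_degreeLT, and_comm]
  have htotal : Fintype.card (Polynomial.degreeLT F k) = q ^ k := by
    rw [Fintype.card_congr (Polynomial.degreeLTEquiv F k).toEquiv]
    simp [hq]
  have hpairs : pairs.card * 2 = n * (n - 1) := by
    simp only [pairs, Finset.card_sigma, Fin.card_Iio]
    rw [Fin.sum_univ_eq_sum_range (fun i => i) n, Finset.sum_range_id_mul_two]
  have hcover : (Finset.univ : Finset (Polynomial.degreeLT F k)) ⊆
      good ∪ pairs.biUnion collide := by
    intro f _
    by_cases hf : Function.Injective fun i => f.1.eval (α i)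
    · simp [hgood, hf]
    · obtain ⟨i, j, hij, hne⟩ : ∃ i j, f.1.eval (α i) = f.1.eval (α j) ∧ i ≠ j := by
        simpa [Function.Injective] using hf
      refine Finset.mem_union_right _ (Finset.mem_biUnion.2 ?_)
      rcases lt_or_gt_of_ne hne with h | h
      · exact ⟨⟨j, i⟩, by simp [pairs, h], by simp [collide, hij]⟩
      · exact ⟨⟨i, j⟩, by simp [pairs, h], by simp [collide, hij]⟩
  have hcollide : ∀ p ∈ pairs, (collide p).card ≤ q ^ (k - 1) := by
    intro p hp
    have hlt : p.2 < p.1 := by simpa [pairs] using hp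
    rw [← hq, ← card_degreeLT_eval_eq hk (hα.ne hlt.ne'), Nat.card_eq_fintype_card,
      Fintype.card_subtype]
  have hbound : q ^ k ≤ good.card + pairs.card * q ^ (k - 1) := by
    rw [← htotal, ← Finset.card_univ]
    exact (Finset.card_le_card hcover).trans <| (Finset.card_union_le _ _).trans <|
      Nat.add_le_add_left (Finset.card_biUnion_le_card_mul _ _ _ hcollide) _
  have hhalf : (n : ℤ) * ((n : ℤ) - 1) / 2 = pairs.card := by
    have h : (pairs.card : ℤ) * 2 = n * ((n : ℤ) - 1) := by
      rw [← Nat.cast_pred (by omega : 0 < n)]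
      exact_mod_cast hpairs
    omega
  rw [hncard, hhalf, mul_sub, ← pow_succ, Nat.sub_add_cancel (by omega : 1 ≤ k)]
  have hboundZ : (q : ℤ) ^ k ≤ good.card + pairs.card * (q : ℤ) ^ (k - 1) := by
    exact_mod_cast hbound
  linarith
end

section
/- Let F_q be a finite field of characteristic p, and let F_1 and F_2 be subfields of F_q whose intersection is the prime subfield F_p. Then for any subsets A ⊆ F_1 and B ⊆ F_2 and any elements δ, γ ∈ F_q, one has |δA ∩ (B + γ)| ≤ p, where δA = {δa : a ∈ A} and B + γ = {b + γ : b ∈ B}. -/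
open Pointwise

/-- if `F₁` and `F₂` are subfields of a finite field `F_q` of characteristic `p`
whose intersection is the prime subfield, then for any subsets `A ⊆ F₁`, `B ⊆ F₂` and any
`δ, γ ∈ F_q` one has `|δA ∩ (B + γ)| ≤ p`. -/
theorem intersection_of_scaled_and_shifted_subfield_subsets_le_char
    {F : Type*} [Field F] [Fintype F] (p : ℕ) [Fact p.Prime] [CharP F p]
    (F1 F2 : Subfield F) (hF : F1 ⊓ F2 = ⊥)
    (A B : Set F) (hA : A ⊆ (F1 : Set F)) (hB : B ⊆ (F2 : Set F))
    (δ γ : F) :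
    ((δ • A) ∩ ((fun x => x + γ) '' B)).ncard ≤ p := by
  rcases Set.subsingleton_or_nontrivial ((δ • A) ∩ ((fun x => x + γ) '' B)) with hS | hS
  · exact (Set.ncard_le_one_iff_subsingleton.mpr hS).trans (Fact.out : p.Prime).one_le
  obtain ⟨x₀, ⟨⟨a₀, ha₀, hx₀⟩, ⟨b₀, hb₀, hy₀⟩⟩, x₁, ⟨⟨a₁, ha₁, hx₁⟩, ⟨b₁, hb₁, hy₁⟩⟩, hne⟩ := hS
  simp only [smul_eq_mul] at hx₀ hx₁ hy₀ hy₁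
  have hδ : δ ≠ 0 := by
    rintro rfl
    exact hne (by rw [← hx₀, ← hx₁, zero_mul, zero_mul])
  have hd : x₁ - x₀ ≠ 0 := sub_ne_zero.mpr hne.symm
  have hsub : (δ • A) ∩ ((fun x => x + γ) '' B) ⊆
      (fun t => x₀ + t * (x₁ - x₀)) '' ((⊥ : Subfield F) : Set F) := by
    rintro x ⟨⟨a, ha, hx⟩, ⟨b, hb, hy⟩⟩
    simp only [smul_eq_mul] at hx hy
    refine ⟨(x - x₀) / (x₁ - x₀), ?_, by dsimp only; rw [div_mul_cancel₀ _ hd]; ring⟩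
    rw [← hF, SetLike.mem_coe, Subfield.mem_inf]
    constructor
    · have h : (x - x₀) / (x₁ - x₀) = (a - a₀) / (a₁ - a₀) := by
        rw [← hx, ← hx₀, ← hx₁, ← mul_sub, ← mul_sub, mul_div_mul_left _ _ hδ]
      rw [h]
      exact div_mem (sub_mem (hA ha) (hA ha₀)) (sub_mem (hA ha₁) (hA ha₀))
    · have h : (x - x₀) / (x₁ - x₀) = (b - b₀) / (b₁ - b₀) := by
        rw [← hy, ← hy₀, ← hy₁, add_sub_add_right_eq_sub, add_sub_add_right_eq_sub]
      rw [h]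
      exact div_mem (sub_mem (hB hb) (hB hb₀)) (sub_mem (hB hb₁) (hB hb₀))
  calc _ ≤ _ := Set.ncard_le_ncard hsub (Set.toFinite _)
    _ ≤ ((⊥ : Subfield F) : Set F).ncard := Set.ncard_image_le (Set.toFinite _)
    _ = p := Subfield.card_bot F p
end

section
/- Let p be a prime and let t_1, t_2 be coprime integers with 5 ≤ t_1 < t_2, and set q = p^{t_1 t_2}. For i = 1, 2 let β_i ∈ F_q be an element of degree t_i over F_p (so F_i := F_p(β_i) has {1, β_i, …, β_i^{t_i − 1}} as an F_p-basis), and define G_i = β_i + span_{F_p}{β_i², …, β_i^{t_1 − 1}} and S = G_1 ∪ G_2. Then G_1 and G_2 are disjoint, |S| = n = 2p^{t_1 − 2}, and for every pair (δ, γ) ∈ F_q × F_q with (δ, γ) ≠ (1, 0) one has |δS ∩ (S + γ)| ≤ n/2 + 1, where δS = {δs : s ∈ S} and S + γ = {s + γ : s ∈ S}. -/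
open Pointwise

/-- The `K`-span of the powers `β², …, β^(n-1)`. -/
def powerSpan (K : Type*) {F : Type*} [Field K] [Field F] [Algebra K F] (β : F) (n : ℕ) :
    Submodule K F :=
  Submodule.span K {y : F | ∃ j : ℕ, 2 ≤ j ∧ j ≤ n - 1 ∧ y = β ^ j}

/-- The coset `β + span {β², …, β^(n-1)}`. -/
def powerCoset (K : Type*) {F : Type*} [Field K] [Field F] [Algebra K F] (β : F) (n : ℕ) :
    Set F :=
  {x | ∃ v ∈ powerSpan K β n, x = β + v}

namespace powerSpan

open Polynomial IntermediateField Module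

variable {K F : Type*} [Field K] [Field F] [Algebra K F] {β δ : F} {n : ℕ}

lemma le_adjoin (β : F) (n : ℕ) {v : F} (hv : v ∈ powerSpan K β n) : v ∈ K⟮β⟯ := by
  have h : powerSpan K β n ≤ Subalgebra.toSubmodule K⟮β⟯.toSubalgebra := by
    refine Submodule.span_le.2 ?_
    rintro _ ⟨j, -, -, rfl⟩
    exact pow_mem (mem_adjoin_simple_self K β) j
  exact h hv

lemma exists_aeval {v : F} (hv : v ∈ powerSpan K β n) :
    ∃ g : K[X], g.degree < ((n - 2 : ℕ) : WithBot ℕ) ∧ v = β ^ 2 * aeval β g := by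
  induction hv using Submodule.span_induction with
  | mem x h =>
    obtain ⟨j, h2, hj, rfl⟩ := h
    refine ⟨X ^ (j - 2), ?_, ?_⟩
    · rw [degree_X_pow]
      exact_mod_cast (by omega : j - 2 < n - 2)
    · rw [map_pow, aeval_X, ← pow_add]
      congr 1
      omega
  | zero => exact ⟨0, by simp [bot_lt_iff_ne_bot], by simp⟩
  | add x y _ _ hx hy =>
    obtain ⟨g, hg, rfl⟩ := hx
    obtain ⟨h, hh, rfl⟩ := hy
    exact ⟨g + h, (degree_add_le _ _).trans_lt (max_lt hg hh), by rw [map_add, mul_add]⟩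
  | smul a x _ hx =>
    obtain ⟨g, hg, rfl⟩ := hx
    exact ⟨a • g, (degree_smul_le _ _).trans_lt hg, by rw [map_smul, mul_smul_comm]⟩

lemma pow_mem_of {j : ℕ} (h2 : 2 ≤ j) (hj : j < n) : β ^ j ∈ powerSpan K β n :=
  Submodule.subset_span ⟨j, h2, by omega, rfl⟩

/-- A polynomial of degree less than that of the minimal polynomial is zero if it vanishes. -/
lemma eq_zero_of_aeval {f : K[X]} (hf : f.degree < ((minpoly K β).natDegree : WithBot ℕ))
    (h0 : aeval β f = 0) : f = 0 := by
  by_contra hne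
  rw [degree_eq_natDegree hne] at hf
  have : f.natDegree < (minpoly K β).natDegree := by exact_mod_cast hf
  have := natDegree_le_natDegree (minpoly.degree_le_of_ne_zero K β hne h0)
  omega

lemma eq_zero_of_smul_add_mem (hn : 2 ≤ n) (hβ : n ≤ (minpoly K β).natDegree) {a c : K}
    (h : algebraMap K F a * β + algebraMap K F c ∈ powerSpan K β n) : a = 0 ∧ c = 0 := by
  obtain ⟨g, hg, hv⟩ := exists_aeval h
  have hz : C a * X + C c - X ^ 2 * g = 0 := by
    refine eq_zero_of_aeval (β := β) ?_ (by simp [hv])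
    refine (degree_sub_le _ _).trans_lt (max_lt ?_ ?_)
    · exact degree_linear_le.trans_lt (by exact_mod_cast (by omega : 1 < _))
    · by_cases hg0 : g = 0
      · simp [hg0, bot_lt_iff_ne_bot]
      rw [degree_eq_natDegree hg0] at hg
      have hg' : g.natDegree < n - 2 := by exact_mod_cast hg
      rw [degree_mul, degree_X_pow, degree_eq_natDegree hg0]
      exact_mod_cast (by omega : 2 + g.natDegree < _)
  have h0 := congrArg (coeff · 0) hz
  have h1 := congrArg (coeff · 1) hz
  have e0 : (X ^ 2 * g).coeff 0 = 0 := by simp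
  have e1 : (X ^ 2 * g).coeff 1 = 0 := by rw [coeff_X_pow_mul']; simp
  simp [e0] at h0
  simp [e1] at h1
  exact ⟨h1, h0⟩

lemma finrank_eq (hβ : n ≤ (minpoly K β).natDegree) :
    finrank K (powerSpan K β n) = n - 2 := by
  have hli : LinearIndependent K fun i : Fin (n - 2) => β ^ ((i : ℕ) + 2) :=
    (linearIndependent_pow (K := K) β).comp
      (fun i : Fin (n - 2) => (⟨i + 2, by omega⟩ : Fin (minpoly K β).natDegree))
      fun i j h => by simpa [Fin.ext_iff] using h
  have hs : {y : F | ∃ j : ℕ, 2 ≤ j ∧ j ≤ n - 1 ∧ y = β ^ j} =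
      Set.range fun i : Fin (n - 2) => β ^ ((i : ℕ) + 2) := by
    ext y
    constructor
    · rintro ⟨j, h2, hj, rfl⟩
      exact ⟨⟨j - 2, by omega⟩, by simp [Nat.sub_add_cancel h2]⟩
    · rintro ⟨i, rfl⟩
      exact ⟨i + 2, by omega, by omega, rfl⟩
  rw [powerSpan, hs, finrank_span_eq_card hli, Fintype.card_fin]

/-- Only scalars can stabilise `powerSpan K β n`. -/
lemma mem_bot_of_stable (hn : 3 ≤ n) (hβ : n ≤ (minpoly K β).natDegree)
    (h : ∀ v ∈ powerSpan K β n, δ * v ∈ powerSpan K β n) :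
    δ ∈ (⊥ : IntermediateField K F) := by
  have hβ0 : β ≠ 0 := by
    rintro rfl
    simp [minpoly.zero] at hβ
    omega
  obtain ⟨g, hg, hgv⟩ := exists_aeval (h _ (pow_mem_of le_rfl (by omega)))
  have hδ : δ = aeval β g := by
    rw [mul_comm] at hgv
    exact mul_left_cancel₀ (pow_ne_zero 2 hβ0) hgv
  by_cases hd : g.natDegree = 0
  · rw [eq_C_of_natDegree_eq_zero hd, aeval_C] at hδ
    exact IntermediateField.mem_bot.2 ⟨_, hδ.symm⟩
  exfalso
  have hg0 : g ≠ 0 := fun h0 => hd (by simp [h0])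
  rw [degree_eq_natDegree hg0] at hg
  have hg' : g.natDegree < n - 2 := by exact_mod_cast hg
  obtain ⟨k, hk, hkv⟩ := exists_aeval
    (h _ (pow_mem_of (j := 2 + (n - 2 - g.natDegree)) (by omega) (by omega)))
  have hdeg : (g * X ^ (n - 2 - g.natDegree)).degree = ((n - 2 : ℕ) : WithBot ℕ) := by
    rw [degree_mul, degree_X_pow, degree_eq_natDegree hg0]
    exact_mod_cast (by omega : g.natDegree + (n - 2 - g.natDegree) = n - 2)
  have hz : g * X ^ (n - 2 - g.natDegree) - k = 0 := by
    refine eq_zero_of_aeval (β := β) ?_ ?_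
    · refine (degree_sub_le _ _).trans_lt (max_lt ?_ (hk.trans_le ?_))
      · rw [hdeg]
        exact_mod_cast (by omega : n - 2 < _)
      · exact_mod_cast (by omega : n - 2 ≤ _)
    · refine mul_left_cancel₀ (pow_ne_zero 2 hβ0) ?_
      rw [map_sub, mul_sub, ← hkv, map_mul, map_pow, aeval_X, ← hδ, pow_add]
      ring
  rw [← sub_eq_zero.1 hz, hdeg] at hk
  exact lt_irrefl _ hk

end powerSpan

namespace powerCoset

open Polynomial IntermediateField Module

variable {K F : Type*} [Field K] [Field F] [Algebra K F] {α β δ γ : F} {n : ℕ}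

lemma mem_adjoin {x : F} (hx : x ∈ powerCoset K β n) : x ∈ K⟮β⟯ := by
  obtain ⟨v, hv, rfl⟩ := hx
  exact add_mem (mem_adjoin_simple_self K β) (powerSpan.le_adjoin β n hv)

lemma notMem_bot (hn : 2 ≤ n) (hβ : n ≤ (minpoly K β).natDegree) {x : F}
    (hx : x ∈ powerCoset K β n) : x ∉ (⊥ : IntermediateField K F) := by
  obtain ⟨v, hv, rfl⟩ := hx
  intro h
  obtain ⟨c, hc⟩ := IntermediateField.mem_bot.1 h
  have := powerSpan.eq_zero_of_smul_add_mem (K := K) (a := -1) (c := c) hn hβ (by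
    rw [hc]; simpa using hv)
  simp at this

lemma disjoint (hn : 2 ≤ n) (hα : n ≤ (minpoly K α).natDegree) (hαβ : K⟮α⟯ ⊓ K⟮β⟯ = ⊥) :
    Disjoint (powerCoset K α n) (powerCoset K β n) :=
  Set.disjoint_left.2 fun _ h1 h2 =>
    notMem_bot hn hα h1 (hαβ ▸ IntermediateField.mem_inf.2 ⟨mem_adjoin h1, mem_adjoin h2⟩)

/-- The intersection of `δ • powerCoset K α n` and the translate of `powerCoset K β n` by `γ`. -/
def overlap (K : Type*) {F : Type*} [Field K] [Field F] [Algebra K F] (n : ℕ) (δ γ α β : F) :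
    Set F :=
  {x | ∃ y ∈ powerCoset K α n, ∃ z ∈ powerCoset K β n, δ * y = x ∧ z + γ = x}

lemma smul_union_inter (A : Set F) (hA : A = powerCoset K α n ∪ powerCoset K β n) :
    (δ • A) ∩ ((fun x => x + γ) '' A) = (overlap K n δ γ α α ∪ overlap K n δ γ β β) ∪
      (overlap K n δ γ α β ∪ overlap K n δ γ β α) := by
  subst hA
  ext x
  simp only [overlap, Set.mem_inter_iff, Set.mem_smul_set, Set.mem_image, Set.mem_union,
    smul_eq_mul, Set.mem_ofPred_eq]
  constructor
  · rintro ⟨⟨y, hy | hy, h1⟩, ⟨z, hz | hz, h2⟩⟩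
    · exact .inl (.inl ⟨y, hy, z, hz, h1, h2⟩)
    · exact .inr (.inl ⟨y, hy, z, hz, h1, h2⟩)
    · exact .inr (.inr ⟨y, hy, z, hz, h1, h2⟩)
    · exact .inl (.inr ⟨y, hy, z, hz, h1, h2⟩)
  · rintro ((⟨y, hy, z, hz, h1, h2⟩ | ⟨y, hy, z, hz, h1, h2⟩) |
      (⟨y, hy, z, hz, h1, h2⟩ | ⟨y, hy, z, hz, h1, h2⟩))
    · exact ⟨⟨y, .inl hy, h1⟩, ⟨z, .inl hz, h2⟩⟩
    · exact ⟨⟨y, .inr hy, h1⟩, ⟨z, .inr hz, h2⟩⟩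
    · exact ⟨⟨y, .inl hy, h1⟩, ⟨z, .inr hz, h2⟩⟩
    · exact ⟨⟨y, .inr hy, h1⟩, ⟨z, .inl hz, h2⟩⟩

lemma overlap_eq_empty_of_adjoin_left (hn : 2 ≤ n) (hβ : n ≤ (minpoly K β).natDegree)
    (hαβ : K⟮α⟯ ⊓ K⟮β⟯ = ⊥) (hδ : δ ∈ K⟮α⟯) (hγ : γ ∈ K⟮α⟯) :
    overlap K n δ γ α β = ∅ := by
  refine Set.eq_empty_of_forall_notMem ?_
  rintro x ⟨y, hy, z, hz, rfl, h⟩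
  refine notMem_bot hn hβ hz (hαβ ▸ IntermediateField.mem_inf.2 ⟨?_, mem_adjoin hz⟩)
  rw [eq_sub_of_add_eq h]
  exact sub_mem (mul_mem hδ (mem_adjoin hy)) hγ

lemma overlap_eq_empty_of_adjoin_right (hn : 2 ≤ n) (hβ : n ≤ (minpoly K β).natDegree)
    (hαβ : K⟮α⟯ ⊓ K⟮β⟯ = ⊥) (hδ0 : δ ≠ 0) (hδ : δ ∈ K⟮α⟯) (hγ : γ ∈ K⟮α⟯) :
    overlap K n δ γ β α = ∅ := by
  refine Set.eq_empty_of_forall_notMem ?_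
  rintro x ⟨y, hy, z, hz, h, rfl⟩
  refine notMem_bot hn hβ hy (hαβ ▸ IntermediateField.mem_inf.2 ⟨?_, mem_adjoin hy⟩)
  rw [eq_div_of_mul_eq hδ0 ((mul_comm _ _).trans h)]
  exact div_mem (add_mem (mem_adjoin hz) hγ) hδ

variable [Finite F]

lemma natCard_powerSpan (hβ : n ≤ (minpoly K β).natDegree) :
    Nat.card (powerSpan K β n) = Nat.card K ^ (n - 2) := by
  rw [Module.natCard_eq_pow_finrank (K := K), powerSpan.finrank_eq hβ]

lemma ncard_eq (hβ : n ≤ (minpoly K β).natDegree) :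
    (powerCoset K β n).ncard = Nat.card K ^ (n - 2) := by
  have : powerCoset K β n = (fun v => β + v) '' (powerSpan K β n : Set F) := by
    ext x
    exact exists_congr fun v => and_congr_right fun _ => eq_comm
  rw [this, Set.ncard_image_of_injective _ (add_right_injective β), ← natCard_powerSpan hβ]
  rfl

/-- An overlap is either empty or a coset of `δ • powerSpan K α n ⊓ powerSpan K β n`. -/
lemma ncard_overlap_le (δ γ α β : F) (n : ℕ) : (overlap K n δ γ α β).ncard ≤
    Nat.card K ^ finrank K
      ↥((powerSpan K α n).map (LinearMap.mulLeft K δ) ⊓ powerSpan K β n) := by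
  rcases (overlap K n δ γ α β).eq_empty_or_nonempty with h | ⟨x₀, hx₀⟩
  · simp [h]
  rw [← Module.natCard_eq_pow_finrank (K := K)]
  change _ ≤ Set.ncard (((powerSpan K α n).map (LinearMap.mulLeft K δ) ⊓ powerSpan K β n :
    Submodule K F) : Set F)
  refine Set.ncard_le_ncard_of_injOn (fun x => x - x₀) ?_
    (sub_left_injective.injOn) (Set.toFinite _)
  obtain ⟨_, ⟨v₀, hv₀, rfl⟩, _, ⟨w₀, hw₀, rfl⟩, h1, h2⟩ := hx₀
  rintro x ⟨_, ⟨v, hv, rfl⟩, _, ⟨w, hw, rfl⟩, h3, h4⟩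
  refine ⟨⟨v - v₀, sub_mem hv hv₀, ?_⟩, ?_⟩
  · rw [LinearMap.mulLeft_apply, ← h1, ← h3]
    ring
  · have : x - x₀ = w - w₀ := by
      rw [← h2, ← h4]
      ring
    change x - x₀ ∈ powerSpan K β n
    rw [this]
    exact sub_mem hw hw₀

lemma ncard_overlap_self_le_one (hδ : δ ∉ K⟮β⟯) : (overlap K n δ γ β β).ncard ≤ 1 := by
  refine (ncard_overlap_le δ γ β β n).trans ?_
  have hbot : (powerSpan K β n).map (LinearMap.mulLeft K δ) ⊓ powerSpan K β n = ⊥ := by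
    refine (Submodule.eq_bot_iff _).2 ?_
    rintro _ ⟨⟨v, hv, rfl⟩, hw⟩
    by_contra hne
    simp only [LinearMap.mulLeft_apply] at hne hw
    refine hδ ?_
    rw [← mul_div_cancel_right₀ δ (right_ne_zero_of_mul hne)]
    exact div_mem (powerSpan.le_adjoin β n hw) (powerSpan.le_adjoin β n hv)
  rw [hbot]
  simp

variable [Finite K]

lemma ncard_overlap_ne_le (hαβ : K⟮α⟯ ⊓ K⟮β⟯ = ⊥) :
    (overlap K n δ γ α β).ncard ≤ Nat.card K := by
  refine (ncard_overlap_le δ γ α β n).trans ?_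
  set W := (powerSpan K α n).map (LinearMap.mulLeft K δ) ⊓ powerSpan K β n with hW
  have h1 : finrank K W ≤ 1 := by
    by_cases hbot : W = ⊥
    · rw [hbot]
      simp
    obtain ⟨w₀, hw₀, hne⟩ := W.ne_bot_iff.1 hbot
    refine finrank_le_one ⟨w₀, hw₀⟩ ?_
    rintro ⟨w, hw⟩
    obtain ⟨⟨v₀, hv₀, rfl⟩, hw₀'⟩ := hw₀
    obtain ⟨⟨v, hv, rfl⟩, hw'⟩ := hw
    simp only [LinearMap.mulLeft_apply] at hne hw₀' hw' ⊢
    have hm : v / v₀ ∈ (⊥ : IntermediateField K F) := by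
      rw [← hαβ]
      refine IntermediateField.mem_inf.2
        ⟨div_mem (powerSpan.le_adjoin α n hv) (powerSpan.le_adjoin α n hv₀), ?_⟩
      rw [← mul_div_mul_left v v₀ (left_ne_zero_of_mul hne)]
      exact div_mem (powerSpan.le_adjoin β n hw') (powerSpan.le_adjoin β n hw₀')
    obtain ⟨c, hc⟩ := IntermediateField.mem_bot.1 hm
    refine ⟨c, Subtype.ext ?_⟩
    have := right_ne_zero_of_mul hne
    simp only [SetLike.mk_smul_mk, Algebra.smul_def, hc]
    field_simp
  simpa using Nat.pow_le_pow_right Nat.card_pos h1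

lemma ncard_overlap_self_le (hβ : n ≤ (minpoly K β).natDegree) :
    (overlap K n δ γ β β).ncard ≤ Nat.card K ^ (n - 2) := by
  refine (ncard_overlap_le δ γ β β n).trans (Nat.pow_le_pow_right Nat.card_pos ?_)
  rw [← powerSpan.finrank_eq hβ]
  exact Submodule.finrank_mono inf_le_right

lemma ncard_overlap_self_le_of_notMem_bot (hn : 3 ≤ n) (hβ : n ≤ (minpoly K β).natDegree)
    (hδ : δ ∉ (⊥ : IntermediateField K F)) :
    (overlap K n δ γ β β).ncard ≤ Nat.card K ^ (n - 3) := by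
  refine (ncard_overlap_le δ γ β β n).trans (Nat.pow_le_pow_right Nat.card_pos ?_)
  have hlt : (powerSpan K β n).map (LinearMap.mulLeft K δ) ⊓ powerSpan K β n <
      powerSpan K β n := by
    refine lt_of_le_of_ne inf_le_right fun heq => hδ ?_
    have hmap : (powerSpan K β n).map (LinearMap.mulLeft K δ) = powerSpan K β n :=
      (Submodule.eq_of_le_of_finrank_le (inf_eq_right.1 heq) (Submodule.finrank_map_le _ _)).symm
    exact powerSpan.mem_bot_of_stable hn hβ fun v hv => by
      rw [← hmap]
      exact ⟨v, hv, rfl⟩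
  have := Submodule.finrank_lt_finrank_of_lt hlt
  rw [powerSpan.finrank_eq hβ] at this
  omega

/-- If `δ` is a scalar and the translate of the first coset meets its dilate, nothing else
contributes. -/
lemma ncard_overlaps_le_of_nonempty (hn : 2 ≤ n) (hα : n ≤ (minpoly K α).natDegree)
    (hβ : n ≤ (minpoly K β).natDegree) (hαβ : K⟮α⟯ ⊓ K⟮β⟯ = ⊥) (hδ0 : δ ≠ 0)
    (hδγ : (δ, γ) ≠ (1, 0)) (hδ : δ ∈ (⊥ : IntermediateField K F))
    (hne : (overlap K n δ γ α α).Nonempty) :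
    (overlap K n δ γ α α).ncard + (overlap K n δ γ β β).ncard +
      ((overlap K n δ γ α β).ncard + (overlap K n δ γ β α).ncard) ≤ Nat.card K ^ (n - 2) := by
  obtain ⟨x, y, hy, z, hz, rfl, hx⟩ := hne
  have hδα : δ ∈ K⟮α⟯ := (bot_le : ⊥ ≤ K⟮α⟯) hδ
  have hδβ : δ ∈ K⟮β⟯ := (bot_le : ⊥ ≤ K⟮β⟯) hδ
  have hγ : γ ∈ K⟮α⟯ := by
    rw [eq_sub_of_add_eq' hx]
    exact sub_mem (mul_mem hδα (mem_adjoin hy)) (mem_adjoin hz)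
  have hββ : overlap K n δ γ β β = ∅ := by
    refine Set.eq_empty_of_forall_notMem ?_
    rintro _ ⟨y', hy', z', hz', rfl, hx'⟩
    have hγβ : γ ∈ K⟮β⟯ := by
      rw [eq_sub_of_add_eq' hx']
      exact sub_mem (mul_mem hδβ (mem_adjoin hy')) (mem_adjoin hz')
    obtain ⟨c, hc⟩ := IntermediateField.mem_bot.1 (hαβ ▸ IntermediateField.mem_inf.2 ⟨hγ, hγβ⟩)
    obtain ⟨a, ha⟩ := IntermediateField.mem_bot.1 hδ
    obtain ⟨v, hv, rfl⟩ := hy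
    obtain ⟨w, hw, rfl⟩ := hz
    have hmem : algebraMap K F (a - 1) * α + algebraMap K F (-c) ∈ powerSpan K α n := by
      have : algebraMap K F (a - 1) * α + algebraMap K F (-c) = w - a • v := by
        rw [Algebra.smul_def, map_sub, map_neg, map_one, ha, hc]
        linear_combination -hx
      rw [this]
      exact sub_mem hw (Submodule.smul_mem _ _ hv)
    obtain ⟨h1, h2⟩ := powerSpan.eq_zero_of_smul_add_mem hn hα hmem
    rw [sub_eq_zero] at h1
    rw [neg_eq_zero] at h2
    subst h1 h2
    exact hδγ (by rw [← ha, ← hc, map_one, map_zero])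
  rw [hββ, overlap_eq_empty_of_adjoin_left hn hβ hαβ hδα hγ,
    overlap_eq_empty_of_adjoin_right hn hβ hαβ hδ0 hδα hγ]
  simpa using ncard_overlap_self_le hα

lemma ncard_overlaps_le (hn : 5 ≤ n) (hα : n ≤ (minpoly K α).natDegree)
    (hβ : n ≤ (minpoly K β).natDegree) (hαβ : K⟮α⟯ ⊓ K⟮β⟯ = ⊥) (hδ0 : δ ≠ 0)
    (hδγ : (δ, γ) ≠ (1, 0)) :
    (overlap K n δ γ α α).ncard + (overlap K n δ γ β β).ncard +
      ((overlap K n δ γ α β).ncard + (overlap K n δ γ β α).ncard) ≤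
      Nat.card K ^ (n - 2) + 1 := by
  have hβα : K⟮β⟯ ⊓ K⟮α⟯ = ⊥ := inf_comm K⟮α⟯ K⟮β⟯ ▸ hαβ
  have c1 := ncard_overlap_ne_le (n := n) (δ := δ) (γ := γ) hαβ
  have c2 := ncard_overlap_ne_le (n := n) (δ := δ) (γ := γ) hβα
  have hK : 2 ≤ Nat.card K := Finite.one_lt_card
  have e1 : Nat.card K ^ 2 ≤ Nat.card K ^ (n - 3) := Nat.pow_le_pow_right Nat.card_pos (by omega)
  have e2 : Nat.card K ^ (n - 2) = Nat.card K ^ (n - 3) * Nat.card K := by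
    rw [← pow_succ]
    congr 1
    omega
  have e3 : Nat.card K ^ (n - 3) + 2 * Nat.card K ≤ Nat.card K ^ (n - 2) := by nlinarith
  by_cases hδ : δ ∈ (⊥ : IntermediateField K F)
  · rcases (overlap K n δ γ α α).eq_empty_or_nonempty with h1 | h1
    · rcases (overlap K n δ γ β β).eq_empty_or_nonempty with h2 | h2
      · rw [h1, h2, Set.ncard_empty]
        omega
      · have := ncard_overlaps_le_of_nonempty (by omega) hβ hα hβα hδ0 hδγ hδ h2
        omega
    · have := ncard_overlaps_le_of_nonempty (by omega) hα hβ hαβ hδ0 hδγ hδ h1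
      omega
  · have d1 := ncard_overlap_self_le_of_notMem_bot (γ := γ) (by omega) hα hδ
    have d2 := ncard_overlap_self_le_of_notMem_bot (γ := γ) (by omega) hβ hδ
    by_cases hδα : δ ∈ K⟮α⟯
    · have hδβ : δ ∉ K⟮β⟯ := fun h => hδ (hαβ ▸ IntermediateField.mem_inf.2 ⟨hδα, h⟩)
      have := ncard_overlap_self_le_one (n := n) (γ := γ) hδβ
      omega
    · have := ncard_overlap_self_le_one (n := n) (γ := γ) hδα
      omega

end powerCoset

/-- for a prime `p`, coprime `5 ≤ t₁ < t₂`, `q = p^(t₁t₂)`, elements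
`β₁, β₂ ∈ F_q` of degrees `t₁, t₂` over `F_p`, and
`Gᵢ = βᵢ + span_{F_p}{βᵢ², …, βᵢ^(t₁-1)}`, `S = G₁ ∪ G₂`: the sets `G₁, G₂` are disjoint,
`|S| = n = 2p^(t₁-2)`, and `|δS ∩ (S + γ)| ≤ n/2 + 1` for every `(δ, γ) ≠ (1, 0)`. -/
theorem union_of_shifted_spans_has_small_intersections
    {F : Type*} [Field F] [Fintype F] (p t1 t2 : ℕ) [Fact p.Prime]
    [Algebra (ZMod p) F]
    (hq : Fintype.card F = p ^ (t1 * t2))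
    (ht1 : 5 ≤ t1) (h12 : t1 < t2) (hco : Nat.Coprime t1 t2)
    (β1 β2 : F)
    (hβ1 : (minpoly (ZMod p) β1).natDegree = t1)
    (hβ2 : (minpoly (ZMod p) β2).natDegree = t2)
    (G1 G2 S : Set F)
    (hG1 : G1 = {x | ∃ v ∈ Submodule.span (ZMod p)
        {y : F | ∃ j : ℕ, 2 ≤ j ∧ j ≤ t1 - 1 ∧ y = β1 ^ j}, x = β1 + v})
    (hG2 : G2 = {x | ∃ v ∈ Submodule.span (ZMod p)
        {y : F | ∃ j : ℕ, 2 ≤ j ∧ j ≤ t1 - 1 ∧ y = β2 ^ j}, x = β2 + v})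
    (hS : S = G1 ∪ G2) :
    Disjoint G1 G2 ∧ S.ncard = 2 * p ^ (t1 - 2) ∧
    ∀ δ γ : F, (δ, γ) ≠ (1, 0) →
      ((δ • S) ∩ ((fun x => x + γ) '' S)).ncard ≤ 2 * p ^ (t1 - 2) / 2 + 1 := by
  have hV1 : G1 = powerCoset (ZMod p) β1 t1 := hG1
  have hV2 : G2 = powerCoset (ZMod p) β2 t1 := hG2
  subst hV1 hV2
  have hα : t1 ≤ (minpoly (ZMod p) β1).natDegree := hβ1.ge
  have hβ : t1 ≤ (minpoly (ZMod p) β2).natDegree := by omega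
  have hint (β : F) : IsIntegral (ZMod p) β := Algebra.IsIntegral.isIntegral β
  have hinf : IntermediateField.adjoin (ZMod p) {β1} ⊓ IntermediateField.adjoin (ZMod p) {β2} =
      ⊥ := by
    refine (IntermediateField.LinearDisjoint.of_finrank_coprime ?_).inf_eq_bot
    rwa [IntermediateField.adjoin.finrank (hint β1), IntermediateField.adjoin.finrank (hint β2),
      hβ1, hβ2]
  have hdisj := powerCoset.disjoint (n := t1) (by omega) hα hinf
  refine ⟨hdisj, ?_, fun δ γ hδγ => ?_⟩
  · rw [hS, Set.ncard_union_eq hdisj, powerCoset.ncard_eq hα, powerCoset.ncard_eq hβ,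
      Nat.card_zmod, two_mul]
  rw [Nat.mul_div_cancel_left _ two_pos]
  by_cases hδ0 : δ = 0
  · have h0 : (δ • S) ∩ ((fun x => x + γ) '' S) ⊆ {0} := by
      rintro x ⟨⟨y, -, rfl⟩, -⟩
      simp [hδ0]
    have := Set.ncard_le_ncard h0
    rw [Set.ncard_singleton] at this
    omega
  have hle := powerCoset.ncard_overlaps_le ht1 hα hβ hinf hδ0 hδγ
  rw [Nat.card_zmod] at hle
  rw [powerCoset.smul_union_inter S hS]
  refine ((Set.ncard_union_le _ _).trans ?_).trans hle
  exact add_le_add (Set.ncard_union_le _ _) (Set.ncard_union_le _ _)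
end

section
/- Let p be a prime and let t_1, t_2 be coprime integers with 5 ≤ t_1 < t_2, and set q = p^{t_1 t_2}. Then there exists a set S ⊆ F_q of size n = 2p^{t_1 − 2} such that the 2-dimensional Reed–Solomon code over F_q with evaluation point set S has minimum insdel distance at least n − 2. -/
open Pointwise

/-- If `n ^ 5 ≤ |F|`, then some sequence of length `n` has no term that is the image of an earlier
term under an affine map sending two earlier terms to earlier terms. Here
`y₁ + (x₃ - x₁) * (y₂ - y₁) / (x₂ - x₁)` is the image of `x₃` under the affine map sending
`x₁, x₂` to `y₁, y₂`; the degenerate case `x₁ = x₂` makes the terms distinct. -/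
theorem exists_affinely_generic_seq {F : Type*} [Field F] [Fintype F] (n : ℕ)
    (hn : n ^ 5 ≤ Fintype.card F) :
    ∃ α : ℕ → F, ∀ k < n, ∀ x₁ < k, ∀ x₂ < k, ∀ x₃ < k, ∀ y₁ < k, ∀ y₂ < k,
      α k ≠ α y₁ + (α x₃ - α x₁) * (α y₂ - α y₁) / (α x₂ - α x₁) := by
  induction n with
  | zero => exact ⟨0, by simp⟩
  | succ n ih =>
    have hlt : n ^ 5 < Fintype.card F :=
      (Nat.pow_lt_pow_left n.lt_succ_self (by norm_num)).trans_le hn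
    obtain ⟨α, hα⟩ := ih hlt.le
    have hns : ¬ Function.Surjective fun v : Fin 5 → Fin n =>
        α (v 3) + (α (v 2) - α (v 0)) * (α (v 4) - α (v 3)) / (α (v 1) - α (v 0)) := by
      intro h
      have := Fintype.card_le_of_surjective _ h
      simp at this
      omega
    simp only [Function.Surjective, not_forall, not_exists] at hns
    obtain ⟨z, hz⟩ := hns
    refine ⟨Function.update α n z, fun k hk x₁ h₁ x₂ h₂ x₃ h₃ y₁ h₄ y₂ h₅ => ?_⟩
    rw [Function.update_of_ne (show x₁ ≠ n by omega), Function.update_of_ne (show x₂ ≠ n by omega),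
      Function.update_of_ne (show x₃ ≠ n by omega), Function.update_of_ne (show y₁ ≠ n by omega),
      Function.update_of_ne (show y₂ ≠ n by omega)]
    rcases (Nat.lt_succ_iff_lt_or_eq.mp hk) with hk | rfl
    · rw [Function.update_of_ne hk.ne]
      exact hα k hk x₁ h₁ x₂ h₂ x₃ h₃ y₁ h₄ y₂ h₅
    · rw [Function.update_self]
      exact fun h => hz ![⟨x₁, h₁⟩, ⟨x₂, h₂⟩, ⟨x₃, h₃⟩, ⟨y₁, h₄⟩, ⟨y₂, h₅⟩] h.symm

/-- A common subsequence survives a single insertion or deletion up to one symbol. -/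
theorem InsDelStep.exists_common_sublist {α : Type*} {a a' b s : List α} {m : ℕ}
    (h : InsDelStep a a') (hs : s.Sublist a') (hsb : s.Sublist b)
    (hm : a'.length + b.length ≤ 2 * s.length + m) :
    ∃ s' : List α, s'.Sublist a ∧ s'.Sublist b ∧
      a.length + b.length ≤ 2 * s'.length + (m + 1) := by
  rcases h with ⟨l, r, x, rfl, rfl⟩ | ⟨l, r, x, rfl, rfl⟩
  · refine ⟨s, hs.trans ((List.sublist_cons_self x r).append_left l), hsb, ?_⟩
    simp only [List.length_append, List.length_cons] at hm ⊢
    omega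
  · obtain ⟨s₁, s₂, rfl, h₁, h₂⟩ := List.sublist_append_iff.mp hs
    rcases List.sublist_cons_iff.mp h₂ with h₂ | ⟨s₃, rfl, h₃⟩
    · refine ⟨s₁ ++ s₂, h₁.append h₂, hsb, ?_⟩
      simp only [List.length_append, List.length_cons] at hm ⊢
      omega
    · refine ⟨s₁ ++ s₃, h₁.append h₃,
        ((List.sublist_cons_self x s₃).append_left s₁).trans hsb, ?_⟩
      simp only [List.length_append, List.length_cons] at hm ⊢
      omega

theorem exists_common_sublist_of_insDelStep_chain {α : Type*} (m : ℕ) (c : ℕ → List α)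
    (hc : ∀ i < m, InsDelStep (c i) (c (i + 1))) :
    ∃ s : List α, s.Sublist (c 0) ∧ s.Sublist (c m) ∧
      (c 0).length + (c m).length ≤ 2 * s.length + m := by
  induction m generalizing c with
  | zero => exact ⟨c 0, List.Sublist.refl _, List.Sublist.refl _, by omega⟩
  | succ m ih =>
    obtain ⟨s, h₁, h₂, h₃⟩ := ih (fun i => c (i + 1)) fun i hi => hc (i + 1) (by omega)
    exact (hc 0 (by omega)).exists_common_sublist h₁ h₂ h₃

theorem reflTransGen_insDelStep_nil {α : Type*} (a : List α) :
    Relation.ReflTransGen InsDelStep a [] := by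
  induction a with
  | nil => exact .refl
  | cons x a ih => exact .head (Or.inl ⟨[], a, x, rfl, rfl⟩) ih

theorem reflTransGen_nil_insDelStep {α : Type*} (a : List α) :
    Relation.ReflTransGen InsDelStep [] a := by
  induction a with
  | nil => exact .refl
  | cons x a ih => exact .tail ih (Or.inr ⟨[], a, x, rfl, rfl⟩)

theorem exists_insDelStep_chain {α : Type*} (a b : List α) :
    ∃ (m : ℕ) (c : ℕ → List α), c 0 = a ∧ c m = b ∧
      ∀ i < m, InsDelStep (c i) (c (i + 1)) := by
  have h : Relation.ReflTransGen InsDelStep a b :=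
    (reflTransGen_insDelStep_nil a).trans (reflTransGen_nil_insDelStep b)
  induction h using Relation.ReflTransGen.head_induction_on with
  | refl => exact ⟨0, fun _ => b, rfl, rfl, by simp⟩
  | @head a _ hstep _ ih =>
    obtain ⟨m, c, h0, hm, hc⟩ := ih
    refine ⟨m + 1, fun i => Nat.casesOn i a c, rfl, hm, fun i hi => ?_⟩
    cases i with
    | zero => simpa [h0] using hstep
    | succ i => exact hc i (by omega)

theorem exists_common_sublist_length_add_length_le {α : Type*} (a b : List α) :
    ∃ s : List α, s.Sublist a ∧ s.Sublist b ∧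
      a.length + b.length ≤ 2 * s.length + insdelDist a b := by
  obtain ⟨c, rfl, hb, hc⟩ := Nat.sInf_mem (exists_insDelStep_chain a b)
  obtain ⟨s, h₁, h₂, h₃⟩ := exists_common_sublist_of_insDelStep_chain _ c hc
  rw [hb] at h₂ h₃
  exact ⟨s, h₁, h₂, h₃⟩

/-- Two distinct affine words on an affinely generic sequence do not match at four
increasing pairs of positions. -/
theorem not_four_matches_of_affinely_generic {F : Type*} [Field F] {n : ℕ} {α : ℕ → F}
    (hα : ∀ k < n, ∀ x₁ < k, ∀ x₂ < k, ∀ x₃ < k, ∀ y₁ < k, ∀ y₂ < k,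
      α k ≠ α y₁ + (α x₃ - α x₁) * (α y₂ - α y₁) / (α x₂ - α x₁))
    {a b a' b' : F} (hne : ¬(a = a' ∧ b = b')) {i j : Fin 4 → ℕ}
    (hi : StrictMono i) (hj : StrictMono j) (hin : ∀ k, i k < n) (hjn : ∀ k, j k < n)
    (h : ∀ k, a * α (i k) + b = a' * α (j k) + b') : False := by
  have hlt : ∀ {x y}, x < y → y < n → α y - α x ≠ 0 := by
    intro x y hxy hy h0
    exact hα y hy x hxy x hxy x hxy x hxy x hxy (by simpa [sub_eq_zero] using h0)
  have hi01 := hlt (hi (show (0 : Fin 4) < 1 by decide)) (hin 1)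
  have hj01 := hlt (hj (show (0 : Fin 4) < 1 by decide)) (hjn 1)
  have e : ∀ k, a * (α (i k) - α (i 0)) = a' * (α (j k) - α (j 0)) := fun k => by
    linear_combination h k - h 0
  have ha : a ≠ 0 := by
    rintro rfl
    have ha' : a' = 0 := by simpa [hj01] using (e 1).symm
    exact hne ⟨ha'.symm, by simpa [ha'] using h 0⟩
  have ha' : a' ≠ 0 := by
    rintro rfl
    exact ha (by simpa [hi01] using e 1)
  obtain ⟨k, hk, hij⟩ : ∃ k : Fin 4, 1 < k ∧ i k ≠ j k := by
    by_contra! hall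
    have h2 := h 2
    have h3 := h 3
    rw [← hall 2 (by decide)] at h2
    rw [← hall 3 (by decide)] at h3
    have h23 := hlt (hi (show (2 : Fin 4) < 3 by decide)) (hin 3)
    have haa : a = a' :=
      mul_right_cancel₀ h23 (by linear_combination h3 - h2)
    exact hne ⟨haa, by linear_combination h2 - α (i 2) * haa⟩
  have hi1 := hi hk
  have hj1 := hj hk
  have hi0 := hi (show (0 : Fin 4) < 1 by decide)
  have hj0 := hj (show (0 : Fin 4) < 1 by decide)
  rcases lt_or_gt_of_ne hij with hlt' | hlt'
  · refine hα (j k) (hjn k) (i 0) (by omega) (i 1) (by omega) (i k) hlt' (j 0) (by omega)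
      (j 1) hj1 ?_
    rw [← sub_eq_iff_eq_add', eq_div_iff hi01]
    refine mul_left_cancel₀ (mul_ne_zero ha ha') ?_
    linear_combination a' * (α (j k) - α (j 0)) * e 1 - a' * (α (j 1) - α (j 0)) * e k
  · refine hα (i k) (hin k) (j 0) (by omega) (j 1) (by omega) (j k) hlt' (i 0) (by omega)
      (i 1) hi1 ?_
    rw [← sub_eq_iff_eq_add', eq_div_iff hj01]
    refine mul_left_cancel₀ (mul_ne_zero ha ha') ?_
    linear_combination a * (α (i 1) - α (i 0)) * e k - a * (α (i k) - α (i 0)) * e 1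

theorem two_mul_pow_pow_five_le_pow {p t1 t2 : ℕ} (hp : 2 ≤ p) (ht1 : 5 ≤ t1) (h12 : t1 < t2) :
    (2 * p ^ (t1 - 2)) ^ 5 ≤ p ^ (t1 * t2) := by
  calc (2 * p ^ (t1 - 2)) ^ 5 ≤ (p * p ^ (t1 - 2)) ^ 5 := by gcongr
    _ = p ^ ((t1 - 2 + 1) * 5) := by rw [← pow_succ', ← pow_mul]
    _ ≤ p ^ (t1 * t2) := Nat.pow_le_pow_right (by omega)
        (Nat.mul_le_mul (by omega) (by omega))

/-- for a prime `p`, coprime integers `5 ≤ t₁ < t₂` and `q = p^(t₁t₂)`, there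
is a set of `n = 2p^(t₁-2)` distinct evaluation points in `F_q` such that the 2-dimensional
Reed–Solomon code with this evaluation point set has minimum insdel distance at least
`n - 2`. -/
theorem exists_rs_code_insdel_distance_ge_length_sub_two
    {F : Type*} [Field F] [Fintype F] (p t1 t2 : ℕ) (hp : p.Prime)
    (hq : Fintype.card F = p ^ (t1 * t2))
    (ht1 : 5 ≤ t1) (h12 : t1 < t2) (hco : Nat.Coprime t1 t2) :
    ∀ n : ℕ, n = 2 * p ^ (t1 - 2) →
      ∃ α : Fin n → F, Function.Injective α ∧
        n - 2 ≤ codeInsdelDist {c | ∃ a b : F, c = fun i => a * α i + b} := by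
  rintro n rfl
  have hcard := two_mul_pow_pow_five_le_pow hp.two_le ht1 h12
  have hn4 : 4 ≤ 2 * p ^ (t1 - 2) := by
    have : 2 ^ 1 ≤ p ^ (t1 - 2) :=
      (Nat.pow_le_pow_left hp.two_le 1).trans (Nat.pow_le_pow_right hp.pos (by omega))
    omega
  rw [← hq] at hcard
  clear hq
  generalize 2 * p ^ (t1 - 2) = n at *
  obtain ⟨α, hα⟩ := exists_affinely_generic_seq n hcard
  refine ⟨fun i => α i, fun x y hxy => ?_, le_csInf ?_ ?_⟩
  · by_contra hne
    rcases lt_or_gt_of_ne hne with hlt | hlt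
    · exact hα y y.2 x hlt x hlt x hlt x hlt x hlt (by simpa using hxy.symm)
    · exact hα x x.2 y hlt y hlt y hlt y hlt y hlt (by simpa using hxy)
  · refine ⟨_, fun _ => 0, ⟨0, 0, by simp⟩, fun _ => 1, ⟨0, 1, by simp⟩, fun h => ?_, rfl⟩
    exact zero_ne_one (congrFun h ⟨0, by omega⟩)
  · rintro _ ⟨_, ⟨a, b, rfl⟩, _, ⟨a', b', rfl⟩, hne, rfl⟩
    obtain ⟨s, hs, hs', hlen⟩ := exists_common_sublist_length_add_length_le
      (List.ofFn fun i : Fin n => a * α i + b) (List.ofFn fun i : Fin n => a' * α i + b')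
    simp only [List.length_ofFn] at hlen
    by_contra hlt
    beta_reduce at hlt
    obtain ⟨f, hf⟩ := List.sublist_iff_exists_fin_orderEmbedding_get_eq.mp hs
    obtain ⟨g, hg⟩ := List.sublist_iff_exists_fin_orderEmbedding_get_eq.mp hs'
    have h4 : 4 ≤ s.length := by omega
    refine not_four_matches_of_affinely_generic (a := a) (b := b) (a' := a') (b' := b')
      (i := fun k => f (Fin.castLE h4 k)) (j := fun k => g (Fin.castLE h4 k)) hα ?_ ?_ ?_ ?_ ?_ ?_
    · rintro ⟨rfl, rfl⟩
      exact hne rfl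
    · exact fun k l hkl => f.strictMono (Fin.strictMono_castLE h4 hkl)
    · exact fun k l hkl => g.strictMono (Fin.strictMono_castLE h4 hkl)
    · exact fun k => (f (Fin.castLE h4 k)).2.trans_eq List.length_ofFn
    · exact fun k => (g (Fin.castLE h4 k)).2.trans_eq List.length_ofFn
    · intro k
      have := (hf (Fin.castLE h4 k)).symm.trans (hg (Fin.castLE h4 k))
      simpa using this
end

section
/- Let p be a prime, s ≥ 1 an integer, and let t_1 < t_2 < … < t_{2^s} be pairwise coprime integers with t_1 ≥ 5. Set q = p^{t_1 t_2 ⋯ t_{2^s}}. For each i, let β_i ∈ F_q be an element of degree t_i over F_p, and define G_i = β_i + span_{F_p}{β_i², …, β_i^{t_1 − 1}} and S = G_1 ∪ ⋯ ∪ G_{2^s}. Then the sets G_i are pairwise disjoint, |S| = 2^s p^{t_1 − 2}, and for every pair (δ, γ) ∈ F_q × F_q with δ ≠ 0 and (δ, γ) ≠ (1, 0), one has |δS ∩ (S + γ)| ≤ p^{t_1 − 2} + Σ_{i=0}^{s−1} ( 2^i(2^i − 1)p + 2^i ). -/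
open Pointwise Function

open Polynomial in
theorem Submodule.exists_aeval_eq_of_mem_span_pow {K F : Type*} [Field K] [Field F] [Algebra K F]
    {β v : F} {d : ℕ}
    (hv : v ∈ Submodule.span K {y : F | ∃ j : ℕ, 2 ≤ j ∧ j ≤ d - 1 ∧ y = β ^ j}) :
    ∃ f : K[X], f.degree < d ∧ f.coeff 0 = 0 ∧ f.coeff 1 = 0 ∧ aeval β f = v := by
  induction hv using Submodule.span_induction with
  | mem x hx =>
    obtain ⟨j, hj, hjd, rfl⟩ := hx
    refine ⟨X ^ j, ?_, ?_, ?_, by simp⟩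
    · rw [degree_X_pow]
      exact_mod_cast (by omega : j < d)
    · rw [coeff_X_pow, if_neg (by omega)]
    · rw [coeff_X_pow, if_neg (by omega)]
  | zero => exact ⟨0, by simp [bot_lt_iff_ne_bot], by simp, by simp, by simp⟩
  | add x y _ _ hx hy =>
    obtain ⟨f, hf, hf0, hf1, rfl⟩ := hx
    obtain ⟨g, hg, hg0, hg1, rfl⟩ := hy
    exact ⟨f + g, (degree_add_le f g).trans_lt (max_lt hf hg), by simp [hf0, hg0],
      by simp [hf1, hg1], by simp⟩
  | smul a x _ hx =>
    obtain ⟨f, hf, hf0, hf1, rfl⟩ := hx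
    exact ⟨a • f, (degree_smul_le a f).trans_lt hf, by simp [hf0], by simp [hf1], by simp⟩

/-- The affine space `β + span {β², …, β^(d - 1)}`. -/
def shiftedSpan (K : Type*) {F : Type*} [Field K] [Field F] [Algebra K F] (β : F) (d : ℕ) :
    Set F :=
  {x | ∃ v ∈ Submodule.span K {y : F | ∃ j : ℕ, 2 ≤ j ∧ j ≤ d - 1 ∧ y = β ^ j}, x = β + v}

section shiftedSpan

open Polynomial

variable {K F : Type*} [Field K] [Field F] [Algebra K F] {β : F} {d : ℕ}

theorem exists_aeval_eq_of_mem_shiftedSpan (hd : 2 ≤ d) {x : F} (hx : x ∈ shiftedSpan K β d) :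
    ∃ f : K[X], f.degree < d ∧ f.coeff 0 = 0 ∧ f.coeff 1 = 1 ∧ aeval β f = x := by
  obtain ⟨v, hv, rfl⟩ := hx
  obtain ⟨f, hf, hf0, hf1, rfl⟩ := Submodule.exists_aeval_eq_of_mem_span_pow hv
  refine ⟨X + f, (degree_add_le _ _).trans_lt (max_lt ?_ hf), by simp [hf0], by simp [hf1],
    by simp⟩
  rw [degree_X]
  exact_mod_cast (by omega : 1 < d)

theorem eq_zero_of_aeval_eq_zero_of_degree_lt (hβ : d ≤ (minpoly K β).natDegree) {f : K[X]}
    (hf : f.degree < d) (h : aeval β f = 0) : f = 0 := by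
  by_contra hne
  have h1 := natDegree_le_natDegree (minpoly.degree_le_of_ne_zero K β hne h)
  have h2 := (natDegree_lt_iff_degree_lt hne).2 hf
  omega

theorem notMem_range_algebraMap_of_mem_shiftedSpan (hd : 2 ≤ d)
    (hβ : d ≤ (minpoly K β).natDegree) {x : F} (hx : x ∈ shiftedSpan K β d) :
    x ∉ (algebraMap K F).range := by
  rintro ⟨c, rfl⟩
  obtain ⟨f, hf, -, hf1, hfx⟩ := exists_aeval_eq_of_mem_shiftedSpan hd hx
  have hC : (C c).degree < d := degree_C_le.trans_lt (by exact_mod_cast (by omega : 0 < d))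
  have h := eq_zero_of_aeval_eq_zero_of_degree_lt hβ
    ((degree_sub_le f (C c)).trans_lt (max_lt hf hC)) (by simp [hfx])
  simpa [hf1, coeff_C] using congrArg (fun g => g.coeff 1) h

theorem eq_one_and_eq_zero_of_mem_shiftedSpan (hd : 2 ≤ d)
    (hβ : d ≤ (minpoly K β).natDegree) {x y : F} (hx : x ∈ shiftedSpan K β d)
    (hy : y ∈ shiftedSpan K β d) {a b : K} (h : algebraMap K F a * x = y + algebraMap K F b) :
    a = 1 ∧ b = 0 := by
  obtain ⟨f, hf, hf0, hf1, rfl⟩ := exists_aeval_eq_of_mem_shiftedSpan hd hx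
  obtain ⟨g, hg, hg0, hg1, rfl⟩ := exists_aeval_eq_of_mem_shiftedSpan hd hy
  have hC : (C b).degree < d := degree_C_le.trans_lt (by exact_mod_cast (by omega : 0 < d))
  have h := eq_zero_of_aeval_eq_zero_of_degree_lt hβ (f := a • f - (g + C b))
    ((degree_sub_le _ _).trans_lt (max_lt ((degree_smul_le a f).trans_lt hf)
      ((degree_add_le _ _).trans_lt (max_lt hg hC)))) (by
        simp [Algebra.smul_def, h])
  have h0 := congrArg (fun g => g.coeff 0) h
  have h1 := congrArg (fun g => g.coeff 1) h
  simp [hf0, hg0, hf1, hg1, coeff_C, sub_eq_zero] at h0 h1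
  exact ⟨h1, h0⟩

theorem ncard_shiftedSpan [Fintype K] [Finite F] (hβ : d ≤ (minpoly K β).natDegree) :
    (shiftedSpan K β d).ncard = Fintype.card K ^ (d - 2) := by
  have himage : shiftedSpan K β d = (fun v => β + v) ''
      (Submodule.span K (Set.range fun i : Fin (d - 2) => β ^ (i.1 + 2)) : Set F) := by
    have : {y : F | ∃ j : ℕ, 2 ≤ j ∧ j ≤ d - 1 ∧ y = β ^ j} =
        Set.range fun i : Fin (d - 2) => β ^ (i.1 + 2) := by
      ext y
      constructor
      · rintro ⟨j, hj, hjd, rfl⟩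
        exact ⟨⟨j - 2, by omega⟩, by simp [Nat.sub_add_cancel hj]⟩
      · rintro ⟨i, rfl⟩
        exact ⟨i + 2, by omega, by omega, rfl⟩
    ext x
    simp only [shiftedSpan, this, Set.mem_ofPred_eq, Set.mem_image, SetLike.mem_coe,
      eq_comm (a := x)]
  have hli : LinearIndependent K fun i : Fin (d - 2) => β ^ (i.1 + 2) :=
    (linearIndependent_pow (K := K) β).comp
      (fun i : Fin (d - 2) => ⟨i.1 + 2, by omega⟩) fun i j h => by
        simpa [Fin.ext_iff] using h
  rw [himage, Set.ncard_image_of_injective _ (add_right_injective β), ← Nat.card_coe_set_eq,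
    ← Nat.card_eq_fintype_card]
  have := Module.natCard_eq_pow_finrank (K := K)
    (V := Submodule.span K (Set.range fun i : Fin (d - 2) => β ^ (i.1 + 2)))
  rwa [finrank_span_eq_card hli, Fintype.card_fin] at this

end shiftedSpan

/-- The elements of `F` fixed by the `n`-th iterate of the Frobenius. -/
def frobeniusFixed (F : Type*) [Field F] (p : ℕ) [ExpChar F p] (n : ℕ) : Subfield F :=
  (iterateFrobenius F p n).eqLocusField (RingHom.id F)

section frobeniusFixed

variable {F : Type*} [Field F] {p : ℕ} [ExpChar F p]

theorem mem_frobeniusFixed {n : ℕ} {x : F} : x ∈ frobeniusFixed F p n ↔ x ^ p ^ n = x :=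
  Iff.rfl

theorem mem_frobeniusFixed_iff_isPeriodicPt {n : ℕ} {x : F} :
    x ∈ frobeniusFixed F p n ↔ IsPeriodicPt (frobenius F p) n x := by
  rw [mem_frobeniusFixed, IsPeriodicPt, IsFixedPt, iterate_frobenius]

theorem frobeniusFixed_mono {m n : ℕ} (h : m ∣ n) : frobeniusFixed F p m ≤ frobeniusFixed F p n :=
  fun _ hx => mem_frobeniusFixed_iff_isPeriodicPt.2
    ((mem_frobeniusFixed_iff_isPeriodicPt.1 hx).trans_dvd h)

theorem mem_range_algebraMap_of_mem_frobeniusFixed [Fact p.Prime] [Algebra (ZMod p) F]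
    {m n : ℕ} (h : m.Coprime n) {x : F} (hm : x ∈ frobeniusFixed F p m)
    (hn : x ∈ frobeniusFixed F p n) : x ∈ (algebraMap (ZMod p) F).range := by
  have h1 := (mem_frobeniusFixed_iff_isPeriodicPt.1 hm).gcd
    (mem_frobeniusFixed_iff_isPeriodicPt.1 hn)
  rw [h.gcd_eq_one, ← mem_frobeniusFixed_iff_isPeriodicPt, mem_frobeniusFixed, pow_one] at h1
  have : CharP F p := charP_of_injective_algebraMap (algebraMap (ZMod p) F).injective p
  rw [← Subfield.mem_bot_iff_pow_eq_self] at h1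
  exact (bot_le : ⊥ ≤ (algebraMap (ZMod p) F).fieldRange) h1

theorem algebraMap_mem_frobeniusFixed [Fact p.Prime] [Algebra (ZMod p) F] (c : ZMod p) (n : ℕ) :
    algebraMap (ZMod p) F c ∈ frobeniusFixed F p n := by
  rw [mem_frobeniusFixed, ← map_pow, ZMod.pow_card_pow]

theorem mem_frobeniusFixed_natDegree_minpoly [Finite F] [Fact p.Prime] [Algebra (ZMod p) F]
    (β : F) : β ∈ frobeniusFixed F p (minpoly (ZMod p) β).natDegree := by
  have hβ : IsIntegral (ZMod p) β := Algebra.IsIntegral.isIntegral β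
  let K := IntermediateField.adjoin (ZMod p) {β}
  have : Fintype K := Fintype.ofFinite K
  have hcard : Fintype.card K = p ^ (minpoly (ZMod p) β).natDegree := by
    rw [Module.card_eq_pow_finrank (K := ZMod p), ZMod.card,
      IntermediateField.adjoin.finrank hβ]
  have h := FiniteField.pow_card (⟨β, IntermediateField.mem_adjoin_simple_self _ β⟩ : K)
  rw [hcard] at h
  exact congrArg Subtype.val h

theorem shiftedSpan_subset_frobeniusFixed [Finite F] [Fact p.Prime] [Algebra (ZMod p) F]
    (β : F) (d : ℕ) :
    shiftedSpan (ZMod p) β d ⊆ frobeniusFixed F p (minpoly (ZMod p) β).natDegree := by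
  rintro _ ⟨v, hv, rfl⟩
  have hβ := mem_frobeniusFixed_natDegree_minpoly (p := p) β
  refine add_mem hβ ?_
  induction hv using Submodule.span_induction with
  | mem x hx =>
    obtain ⟨j, -, -, rfl⟩ := hx
    exact pow_mem hβ j
  | zero => exact zero_mem _
  | add x y _ _ hx hy => exact add_mem hx hy
  | smul a x _ hx =>
    rw [Algebra.smul_def]
    exact mul_mem (algebraMap_mem_frobeniusFixed a _) hx

end frobeniusFixed

section pairs

variable {ι : Type*} [DecidableEq ι]

/-- If every two distinct pairs of `E` jointly involve all indices of `E`, then `E` has at most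
four elements. -/
theorem card_le_four_of_forall_subset_union {E : Finset (ι × ι)}
    (hE : ∀ e ∈ E, ∀ e' ∈ E, e ≠ e' → ∀ f ∈ E,
      ({f.1, f.2} : Finset ι) ⊆ {e.1, e.2} ∪ {e'.1, e'.2}) :
    E.card ≤ 4 := by
  by_cases h1 : E.card ≤ 1
  · omega
  obtain ⟨a, ha, b, hb, hab⟩ := Finset.one_lt_card.1 (not_le.1 h1)
  set A : Finset ι := {a.1, a.2} ∪ {b.1, b.2} with hA
  have hA4 : A.card ≤ 4 :=
    (Finset.card_union_le _ _).trans (add_le_add Finset.card_le_two Finset.card_le_two)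
  by_cases hA2 : A.card ≤ 2
  · have hsub : E ⊆ A ×ˢ A := fun f hf => by
      have h := hE a ha b hb hab f hf
      exact Finset.mem_product.2 ⟨h (by simp), h (by simp)⟩
    have := Finset.card_le_card hsub
    rw [Finset.card_product] at this
    nlinarith
  · have hmiss : ∀ e : ι × ι, ∃ i ∈ A, i ∉ ({e.1, e.2} : Finset ι) := fun e =>
      Finset.exists_mem_notMem_of_card_lt_card
        (lt_of_le_of_lt Finset.card_le_two (not_le.1 hA2))
    choose g hgA hg using hmiss
    refine (Finset.card_le_card_of_injOn g (fun e _ => hgA e) fun e he e' he' heq => ?_).trans hA4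
    by_contra hne
    have hsub : A ⊆ {e.1, e.2} ∪ {e'.1, e'.2} :=
      Finset.union_subset (hE e he e' he' hne a ha) (hE e he e' he' hne b hb)
    rcases Finset.mem_union.1 (hsub (hgA e)) with h | h
    · exact hg e h
    · exact hg e' (heq ▸ h)

end pairs

section intersections

variable {F ι : Type*} [Field F] {p : ℕ} [ExpChar F p] {t : ι → ℕ}

theorem frobeniusFixed_le_prod {A : Finset ι} {i : ι} (hi : i ∈ A) :
    frobeniusFixed F p (t i) ≤ frobeniusFixed F p (∏ a ∈ A, t a) :=
  frobeniusFixed_mono (Finset.dvd_prod_of_mem t hi)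

theorem mem_frobeniusFixed_of_two_solutions {δ γ x x' : F} {n : ℕ}
    (hx : x ∈ frobeniusFixed F p n) (hx' : x' ∈ frobeniusFixed F p n)
    (hy : δ * x - γ ∈ frobeniusFixed F p n) (hy' : δ * x' - γ ∈ frobeniusFixed F p n)
    (hne : x ≠ x') : δ ∈ frobeniusFixed F p n ∧ γ ∈ frobeniusFixed F p n := by
  have hδ : δ ∈ frobeniusFixed F p n := by
    have h : δ = ((δ * x - γ) - (δ * x' - γ)) / (x - x') := by
      rw [eq_div_iff (sub_ne_zero.2 hne)]
      ring
    rw [h]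
    exact div_mem (sub_mem hy hy') (sub_mem hx hx')
  refine ⟨hδ, ?_⟩
  have h := sub_mem (mul_mem hδ hx) hy
  rwa [sub_sub_cancel] at h

variable [Fact p.Prime] [Algebra (ZMod p) F] {G : ι → Set F}

theorem indices_mem_of_solution
    (hco : Pairwise (Nat.Coprime on t))
    (hfix : ∀ i, G i ⊆ frobeniusFixed F p (t i))
    (hprime : ∀ i, ∀ x ∈ G i, x ∉ (algebraMap (ZMod p) F).range)
    (hrigid : ∀ i, ∀ x ∈ G i, ∀ y ∈ G i, ∀ a b : ZMod p,
      algebraMap (ZMod p) F a * x = y + algebraMap (ZMod p) F b → a = 1 ∧ b = 0)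
    {δ γ : F} (hδ : δ ≠ 0) (hδγ : (δ, γ) ≠ (1, 0)) {A : Finset ι}
    (hδA : δ ∈ frobeniusFixed F p (∏ a ∈ A, t a)) (hγA : γ ∈ frobeniusFixed F p (∏ a ∈ A, t a))
    {x : F} {i j : ι} (hx : x ∈ G i) (hy : δ * x - γ ∈ G j) : i ∈ A ∧ j ∈ A := by
  have hcoA : ∀ i ∉ A, (∏ a ∈ A, t a).Coprime (t i) := fun i hi =>
    Nat.Coprime.prod_left fun a ha => hco (fun h => hi (h ▸ ha))
  have hxf := hfix i hx
  have hyf := hfix j hy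
  by_cases hij : i = j
  · subst hij
    suffices i ∈ A from ⟨this, this⟩
    by_contra hi
    obtain ⟨a, ha⟩ : δ ∈ (algebraMap (ZMod p) F).range := by
      have hσδ : δ ^ p ^ (∏ a ∈ A, t a) = δ := hδA
      have hσγ : γ ^ p ^ (∏ a ∈ A, t a) = γ := hγA
      have hσx : x ^ p ^ (∏ a ∈ A, t a) ≠ x := fun h =>
        hprime i x hx (mem_range_algebraMap_of_mem_frobeniusFixed (hcoA i hi) h hxf)
      have hσy : (δ * x - γ) ^ p ^ (∏ a ∈ A, t a) = δ * x ^ p ^ (∏ a ∈ A, t a) - γ := by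
        rw [sub_pow_expChar_pow, mul_pow, hσδ, hσγ]
      refine mem_range_algebraMap_of_mem_frobeniusFixed (hcoA i hi) hδA
        (mem_frobeniusFixed_of_two_solutions hxf (pow_mem hxf _) hyf ?_ hσx.symm).1
      rw [← hσy]
      exact pow_mem hyf _
    have hγi : γ ∈ frobeniusFixed F p (t i) := by
      have h := sub_mem (mul_mem (ha ▸ algebraMap_mem_frobeniusFixed a (t i)) hxf) hyf
      rwa [sub_sub_cancel] at h
    obtain ⟨b, hb⟩ := mem_range_algebraMap_of_mem_frobeniusFixed (hcoA i hi) hγA hγi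
    obtain ⟨rfl, rfl⟩ := hrigid i x hx _ hy a b (by rw [ha, hb]; ring)
    exact hδγ (by rw [← ha, ← hb, map_one, map_zero])
  · constructor
    · by_contra hi
      have hδB := frobeniusFixed_mono (dvd_mul_right _ (t j)) hδA
      have hγB := frobeniusFixed_mono (dvd_mul_right _ (t j)) hγA
      have hyB := frobeniusFixed_mono (dvd_mul_left _ (∏ a ∈ A, t a)) hyf
      have hxB := div_mem (add_mem hyB hγB) hδB
      rw [sub_add_cancel, mul_div_cancel_left₀ _ hδ] at hxB
      exact hprime i x hx (mem_range_algebraMap_of_mem_frobeniusFixed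
        (Nat.Coprime.mul_left (hcoA i hi) (hco (Ne.symm hij))) hxB hxf)
    · by_contra hj
      have hδB := frobeniusFixed_mono (dvd_mul_right _ (t i)) hδA
      have hγB := frobeniusFixed_mono (dvd_mul_right _ (t i)) hγA
      have hxB := frobeniusFixed_mono (dvd_mul_left _ (∏ a ∈ A, t a)) hxf
      exact hprime j _ hy (mem_range_algebraMap_of_mem_frobeniusFixed
        (Nat.Coprime.mul_left (hcoA j hj) (hco hij)) (sub_mem (mul_mem hδB hxB) hγB) hyf)

theorem ncard_solutions_le {m n : ℕ} (hmn : m.Coprime n) {X Y : Set F}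
    (hX : X ⊆ frobeniusFixed F p m) (hY : Y ⊆ frobeniusFixed F p n) {δ : F} (hδ : δ ≠ 0) (γ : F) :
    {x | x ∈ X ∧ δ * x - γ ∈ Y}.ncard ≤ p := by
  set T := {x | x ∈ X ∧ δ * x - γ ∈ Y} with hT
  have hp : p ≠ 0 := (Fact.out : p.Prime).ne_zero
  by_cases hsub : T.Subsingleton
  · exact ((Set.ncard_le_one hsub.finite).2 fun _ ha _ hb => hsub ha hb).trans
      (Nat.one_le_iff_ne_zero.2 hp)
  obtain ⟨a, ha, b, hb, hab⟩ := Set.not_subsingleton_iff.1 hsub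
  have hba : b - a ≠ 0 := sub_ne_zero.2 hab.symm
  have hline : T ⊆ (fun c : ZMod p => a + algebraMap (ZMod p) F c * (b - a)) '' Set.univ := by
    intro x hx
    have hm := div_mem (sub_mem (hX hx.1) (hX ha.1)) (sub_mem (hX hb.1) (hX ha.1))
    have hn := div_mem (sub_mem (hY hx.2) (hY ha.2)) (sub_mem (hY hb.2) (hY ha.2))
    have heq : ((δ * x - γ) - (δ * a - γ)) / ((δ * b - γ) - (δ * a - γ)) = (x - a) / (b - a) := by
      rw [sub_sub_sub_cancel_right, sub_sub_sub_cancel_right, ← mul_sub, ← mul_sub,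
        mul_div_mul_left _ _ hδ]
    rw [heq] at hn
    obtain ⟨c, hc⟩ := mem_range_algebraMap_of_mem_frobeniusFixed hmn hm hn
    exact ⟨c, trivial, by simp only [hc, div_mul_cancel₀ _ hba, add_sub_cancel]⟩
  calc T.ncard ≤ _ := Set.ncard_le_ncard hline (Set.toFinite _)
    _ ≤ (Set.univ : Set (ZMod p)).ncard := Set.ncard_image_le (Set.toFinite _)
    _ = p := by rw [Set.ncard_univ, Nat.card_zmod]

theorem ncard_solutions_iUnion_le [Finite F] {N : ℕ}
    (hco : Pairwise (Nat.Coprime on t))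
    (hfix : ∀ i, G i ⊆ frobeniusFixed F p (t i))
    (hprime : ∀ i, ∀ x ∈ G i, x ∉ (algebraMap (ZMod p) F).range)
    (hrigid : ∀ i, ∀ x ∈ G i, ∀ y ∈ G i, ∀ a b : ZMod p,
      algebraMap (ZMod p) F a * x = y + algebraMap (ZMod p) F b → a = 1 ∧ b = 0)
    (hcard : ∀ i, (G i).ncard ≤ N) (hN : p * 4 ≤ N)
    {δ γ : F} (hδ : δ ≠ 0) (hδγ : (δ, γ) ≠ (1, 0)) :
    {x | x ∈ ⋃ i, G i ∧ δ * x - γ ∈ ⋃ i, G i}.ncard ≤ N := by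
  classical
  set T := {x | x ∈ ⋃ i, G i ∧ δ * x - γ ∈ ⋃ i, G i} with hT
  rcases isEmpty_or_nonempty ι with hι | hι
  · simp [hT]
  have hidx : ∀ x, ∃ e : ι × ι, x ∈ T → x ∈ G e.1 ∧ δ * x - γ ∈ G e.2 := fun x => by
    by_cases hx : x ∈ T
    · obtain ⟨i, hi⟩ := Set.mem_iUnion.1 hx.1
      obtain ⟨j, hj⟩ := Set.mem_iUnion.1 hx.2
      exact ⟨(i, j), fun _ => ⟨hi, hj⟩⟩
    · exact ⟨Classical.arbitrary _, fun h => absurd h hx⟩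
  choose e he using hidx
  have hcover : ∀ x ∈ T, ∀ x' ∈ T, x ≠ x' → ∀ z ∈ T,
      ({(e z).1, (e z).2} : Finset ι) ⊆ {(e x).1, (e x).2} ∪ {(e x').1, (e x').2} := by
    intro x hx x' hx' hne z hz
    set A : Finset ι := {(e x).1, (e x).2} ∪ {(e x').1, (e x').2} with hA
    have hle : ∀ i ∈ A, G i ⊆ frobeniusFixed F p (∏ a ∈ A, t a) := fun i hi =>
      (hfix i).trans (frobeniusFixed_le_prod hi)
    obtain ⟨hδA, hγA⟩ := mem_frobeniusFixed_of_two_solutions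
      (hle (e x).1 (by simp [hA]) (he x hx).1) (hle (e x').1 (by simp [hA]) (he x' hx').1)
      (hle (e x).2 (by simp [hA]) (he x hx).2) (hle (e x').2 (by simp [hA]) (he x' hx').2) hne
    have h := indices_mem_of_solution hco hfix hprime hrigid hδ hδγ hδA hγA (he z hz).1 (he z hz).2
    simpa [Finset.insert_subset_iff] using h
  by_cases hdiag : ∃ x ∈ T, ∃ x' ∈ T, x ≠ x' ∧ (e x).1 = (e x).2 ∧ e x' = e x
  · obtain ⟨x, hx, x', hx', hne, hxd, hxx'⟩ := hdiag
    refine (Set.ncard_le_ncard (fun z hz => ?_) (Set.toFinite _)).trans (hcard (e x).1)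
    have h := hcover x hx x' hx' hne z hz (Finset.mem_insert_self _ _)
    rw [hxx', Finset.union_self, ← hxd, Finset.pair_eq_singleton, Finset.mem_singleton] at h
    exact h ▸ (he z hz).1
  · have hTfin : T.Finite := Set.toFinite T
    have h4 : (hTfin.toFinset.image e).card ≤ 4 := by
      refine card_le_four_of_forall_subset_union ?_
      simp only [Finset.forall_mem_image, Set.Finite.mem_toFinset]
      exact fun x hx x' hx' hne z hz => hcover x hx x' hx' (fun h => hne (h ▸ rfl)) z hz
    rw [Set.ncard_eq_toFinset_card T hTfin]
    refine ((Finset.card_le_mul_card_image _ p fun f hf => ?_).trans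
      (Nat.mul_le_mul_left p h4)).trans hN
    obtain ⟨x, hx, rfl⟩ := Finset.mem_image.1 hf
    rw [Set.Finite.mem_toFinset] at hx
    by_cases hxd : (e x).1 = (e x).2
    · refine le_trans (Finset.card_le_one.2 fun y hy z hz => ?_)
        (Fact.out : p.Prime).one_le
      rw [Finset.mem_filter, Set.Finite.mem_toFinset] at hy hz
      by_contra hyz
      exact hdiag ⟨y, hy.1, z, hz.1, hyz, by rw [hy.2, hxd], by rw [hy.2, hz.2]⟩
    · rw [← Set.ncard_coe_finset]
      refine (Set.ncard_le_ncard (fun y hy => ?_) (Set.toFinite _)).trans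
        (ncard_solutions_le (hco hxd) (hfix _) (hfix _) hδ γ)
      rw [Finset.mem_coe, Finset.mem_filter, Set.Finite.mem_toFinset] at hy
      exact hy.2 ▸ he y hy.1

end intersections

/-- for a prime `p`, `s ≥ 1`, pairwise coprime `t 0 < t 1 < … < t (2^s - 1)`
with `t 0 ≥ 5`, `q = p^(t 0 ⋯ t (2^s - 1))`, elements `β i ∈ F_q` of degree `t i` over `F_p`
and `G i = β i + span_{F_p}{(β i)², …, (β i)^(t 0 - 1)}`, `S = ⋃ i, G i`: the `G i` are
pairwise disjoint, `|S| = 2^s p^(t 0 - 2)`, and for every `(δ, γ)` with `δ ≠ 0` and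
`(δ, γ) ≠ (1, 0)`,
`|δS ∩ (S + γ)| ≤ p^(t 0 - 2) + ∑_{i=0}^{s-1} (2^i(2^i - 1)p + 2^i)`. -/
theorem union_of_shifted_spans_small_intersections_general
    {F : Type*} [Field F] [Fintype F] (p s : ℕ) [Fact p.Prime] (hs : 1 ≤ s)
    [Algebra (ZMod p) F]
    (t : Fin (2 ^ s) → ℕ)
    (hmono : StrictMono t)
    (ht1 : 5 ≤ t ⟨0, by positivity⟩)
    (hco : Pairwise (Nat.Coprime on t))
    (hq : Fintype.card F = p ^ (∏ i, t i))
    (β : Fin (2 ^ s) → F)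
    (hβ : ∀ i, (minpoly (ZMod p) (β i)).natDegree = t i)
    (G : Fin (2 ^ s) → Set F)
    (hG : ∀ i, G i = {x | ∃ v ∈ Submodule.span (ZMod p)
        {y : F | ∃ j : ℕ, 2 ≤ j ∧ j ≤ t ⟨0, by positivity⟩ - 1 ∧ y = β i ^ j},
        x = β i + v})
    (S : Set F) (hS : S = ⋃ i, G i) :
    Pairwise (Disjoint on G) ∧
    S.ncard = 2 ^ s * p ^ (t ⟨0, by positivity⟩ - 2) ∧
    ∀ δ γ : F, δ ≠ 0 → (δ, γ) ≠ (1, 0) →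
      ((δ • S) ∩ ((fun x => x + γ) '' S)).ncard ≤
        p ^ (t ⟨0, by positivity⟩ - 2) +
          ∑ i ∈ Finset.range s, (2 ^ i * (2 ^ i - 1) * p + 2 ^ i) := by
  have : CharP F p := charP_of_injective_algebraMap (algebraMap (ZMod p) F).injective p
  set d := t ⟨0, by positivity⟩ with hd
  have hd2 : 2 ≤ d := by omega
  replace hG : ∀ i, G i = shiftedSpan (ZMod p) (β i) d := hG
  have hdeg : ∀ i, d ≤ (minpoly (ZMod p) (β i)).natDegree := fun i =>
    (hβ i).symm ▸ hmono.monotone (Fin.mk_le_of_le_val (Nat.zero_le _))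
  have hfix : ∀ i, G i ⊆ frobeniusFixed F p (t i) := fun i => by
    rw [hG, ← hβ]
    exact shiftedSpan_subset_frobeniusFixed (β i) d
  have hprime : ∀ i, ∀ x ∈ G i, x ∉ (algebraMap (ZMod p) F).range := fun i x hx =>
    notMem_range_algebraMap_of_mem_shiftedSpan hd2 (hdeg i) (hG i ▸ hx)
  have hrigid : ∀ i, ∀ x ∈ G i, ∀ y ∈ G i, ∀ a b : ZMod p,
      algebraMap (ZMod p) F a * x = y + algebraMap (ZMod p) F b → a = 1 ∧ b = 0 :=
    fun i x hx y hy a b =>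
      eq_one_and_eq_zero_of_mem_shiftedSpan hd2 (hdeg i) (hG i ▸ hx) (hG i ▸ hy)
  have hcard : ∀ i, (G i).ncard = p ^ (d - 2) := fun i => by
    rw [hG, ncard_shiftedSpan (hdeg i), ZMod.card]
  have hdisj : Pairwise (Disjoint on G) := fun i j hij =>
    Set.disjoint_left.2 fun x hi hj => hprime i x hi
      (mem_range_algebraMap_of_mem_frobeniusFixed (hco hij) (hfix i hi) (hfix j hj))
  refine ⟨hdisj, ?_, fun δ γ hδ hδγ => ?_⟩
  · rw [hS, Set.ncard_iUnion_of_finite (fun i => Set.toFinite _) hdisj,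
      finsum_eq_sum_of_fintype, Finset.sum_congr rfl fun i _ => hcard i]
    simp
  · have hp2 : 2 ≤ p := (Fact.out : p.Prime).two_le
    have hN : p * 4 ≤ p ^ (d - 2) :=
      calc p * 4 ≤ p ^ 3 := by nlinarith [Nat.mul_le_mul hp2 hp2]
        _ ≤ p ^ (d - 2) := Nat.pow_le_pow_right (by omega) (by omega)
    have hsub : (δ • S) ∩ ((fun x => x + γ) '' S) ⊆
        (fun x => δ * x) '' {x | x ∈ ⋃ i, G i ∧ δ * x - γ ∈ ⋃ i, G i} := by
      rintro _ ⟨⟨x, hx, rfl⟩, y, hy, hxy⟩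
      have hxy' : y = δ * x - γ := eq_sub_of_add_eq hxy
      exact ⟨x, ⟨hS ▸ hx, hS ▸ hxy' ▸ hy⟩, rfl⟩
    calc _ ≤ _ := Set.ncard_le_ncard hsub (Set.toFinite _)
      _ ≤ _ := Set.ncard_image_le (Set.toFinite _)
      _ ≤ p ^ (d - 2) := ncard_solutions_iUnion_le hco hfix hprime hrigid
        (fun i => (hcard i).le) hN hδ hδγ
      _ ≤ _ := Nat.le_add_right _ _
end

section
/- Let q = p^s be a prime power with q − 1 = ef for integers e, f > 1, let g be a generator of the multiplicative group F_q^*, and set e' = (q−1)/f. Let h(x) = Σ_{i=0}^{f−1} a_i x^i be a polynomial with integer coefficients satisfying Σ_{i=0}^{f−1} a_i² ≥ 3 and p^{ord_f(p)} > (Σ_{i=0}^{f−1} a_i²)^{f/2}. Then h(g^e) = 0 in F_q if and only if h(ζ_f) = 0 in ℂ, where ζ_f is a primitive f-th root of unity in ℂ. -/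
open Polynomial Finset NumberField

/-- Parseval's identity for the values of an integer polynomial at the roots of unity. -/
theorem sum_sq_norm_aeval_pow_primitiveRoot {f : ℕ} (hf : 0 < f) {h : ℤ[X]}
    (hdeg : h.natDegree < f) {ζ : ℂ} (hζ : IsPrimitiveRoot ζ f) :
    ∑ j ∈ range f, ‖aeval (ζ ^ j) h‖ ^ 2 =
      f * ((∑ i ∈ range f, h.coeff i ^ 2 : ℤ) : ℝ) := by
  have hconj : (starRingEnd ℂ) ζ = ζ⁻¹ :=
    (Complex.inv_eq_conj (hζ.norm'_eq_one hf.ne')).symm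
  have horth : ∀ a ∈ range f, ∀ b ∈ range f,
      ∑ j ∈ range f, (ζ ^ j) ^ a * ((ζ⁻¹) ^ j) ^ b = if a = b then (f : ℂ) else 0 := by
    intro a ha b hb
    have h0 : ζ ≠ 0 := hζ.ne_zero hf.ne'
    have hterm : ∀ j, (ζ ^ j) ^ a * ((ζ⁻¹) ^ j) ^ b = (ζ ^ a * (ζ ^ b)⁻¹) ^ j := by
      intro j
      rw [mul_pow, inv_pow, inv_pow, inv_pow, ← pow_mul, ← pow_mul, ← pow_mul, ← pow_mul,
        mul_comm j a, mul_comm j b]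
    simp_rw [hterm]
    split_ifs with hab
    · subst hab
      simp [h0]
    · have hne : ζ ^ a * (ζ ^ b)⁻¹ ≠ 1 := by
        intro h1
        rw [← div_eq_mul_inv, div_eq_one_iff_eq (pow_ne_zero _ h0)] at h1
        exact hab (hζ.pow_inj (mem_range.1 ha) (mem_range.1 hb) h1)
      rw [geom_sum_eq hne]
      have : (ζ ^ a * (ζ ^ b)⁻¹) ^ f = 1 := by
        rw [mul_pow, inv_pow, ← pow_mul, ← pow_mul, mul_comm a, mul_comm b, pow_mul, pow_mul,
          hζ.pow_eq_one]
        simp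
      simp [this]
  have key : ∀ j, ((‖aeval (ζ ^ j) h‖ ^ 2 : ℝ) : ℂ) =
      ∑ a ∈ range f, ∑ b ∈ range f,
        (h.coeff a : ℂ) * h.coeff b * ((ζ ^ j) ^ a * ((ζ⁻¹) ^ j) ^ b) := by
    intro j
    push_cast
    rw [← Complex.mul_conj', aeval_eq_sum_range' hdeg, map_sum, sum_mul_sum]
    refine sum_congr rfl fun a _ => sum_congr rfl fun b _ => ?_
    simp only [zsmul_eq_mul, map_mul, map_pow, hconj, map_intCast]
    ring
  apply Complex.ofReal_injective
  rw [Complex.ofReal_sum, sum_congr rfl fun j _ => key j, sum_comm]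
  have : ∀ a ∈ range f, ∑ j ∈ range f, ∑ b ∈ range f,
      (h.coeff a : ℂ) * h.coeff b * ((ζ ^ j) ^ a * ((ζ⁻¹) ^ j) ^ b) =
      f * (h.coeff a : ℂ) ^ 2 := by
    intro a ha
    rw [sum_comm]
    simp_rw [← mul_sum]
    rw [sum_congr rfl fun b hb => by rw [horth a ha b hb]]
    simp only [mul_ite, mul_zero, sum_ite_eq, ha, if_true]
    ring
  rw [sum_congr rfl this, ← mul_sum]
  push_cast
  rfl

/-- A subring of a finite field of characteristic `p` containing an element of order `f` has at
least `p ^ ord_f(p)` elements. -/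
theorem pow_orderOf_le_card_subring {F : Type*} [Field F] [Fintype F] {p s : ℕ} (hp : p.Prime)
    (hq : Fintype.card F = p ^ s) (R : Subring F) {x : F} (hx : x ∈ R) (hx0 : x ≠ 0) :
    p ^ orderOf (p : ZMod (orderOf x)) ≤ Nat.card R := by
  classical
  have hdvd : Nat.card R ∣ p ^ s := by
    rw [← hq, ← Nat.card_eq_fintype_card]
    exact AddSubgroup.card_addSubgroup_dvd_card R.toAddSubgroup
  obtain ⟨m, -, hm⟩ := (Nat.dvd_prime_pow hp).1 hdvd
  have hm0 : 0 < m := by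
    rcases Nat.eq_zero_or_pos m with rfl | h
    · have : 1 < Nat.card R := Finite.one_lt_card
      rw [hm, pow_zero] at this
      exact absurd this (lt_irrefl 1)
    · exact h
  let : Fintype R := Fintype.ofFinite R
  let : Field R := Fintype.fieldOfDomain R
  have h1 : (⟨x, hx⟩ : R) ^ (Fintype.card R - 1) = 1 :=
    FiniteField.pow_card_sub_one_eq_one _ fun h => hx0 (congrArg Subtype.val h)
  rw [← Nat.card_eq_fintype_card, hm] at h1
  have h2 : x ^ (p ^ m - 1) = 1 := congrArg Subtype.val h1
  have h3 : ((p : ZMod (orderOf x))) ^ m = 1 := by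
    have h4 := (ZMod.natCast_eq_zero_iff _ _).2 (orderOf_dvd_of_pow_eq_one h2)
    rw [Nat.cast_sub (Nat.one_le_pow _ _ hp.pos), sub_eq_zero] at h4
    simpa using h4
  rw [hm]
  exact Nat.pow_le_pow_right hp.pos (Nat.le_of_dvd hm0 (orderOf_dvd_of_pow_eq_one h3))

/-- The inequality between arithmetic and geometric means, without weights or roots. -/
theorem prod_le_sum_div_card_pow {ι : Type*} (s : Finset ι) (hs : s.Nonempty) (z : ι → ℝ)
    (hz : ∀ i ∈ s, 0 ≤ z i) : ∏ i ∈ s, z i ≤ ((∑ i ∈ s, z i) / #s) ^ #s := by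
  have hc : (0 : ℝ) < #s := by exact_mod_cast hs.card_pos
  have h := Real.geom_mean_le_arith_mean s (fun _ => 1) z (by simp) (by simpa using hc) hz
  simp only [Real.rpow_one, sum_const, nsmul_eq_mul, mul_one, one_mul] at h
  have hp := prod_nonneg hz
  calc ∏ i ∈ s, z i = ((∏ i ∈ s, z i) ^ ((#s : ℝ)⁻¹)) ^ #s :=
        (Real.rpow_inv_natCast_pow hp hs.card_pos.ne').symm
    _ ≤ _ := pow_le_pow_left₀ (Real.rpow_nonneg hp _) h _

theorem mul_div_pow_le_pow {n m : ℕ} (hn : 0 < n) (hnm : n ≤ m) {S : ℝ} (hS : 3 ≤ S) :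
    (m * S / n) ^ n ≤ S ^ m := by
  have hn' : (0 : ℝ) < n := by exact_mod_cast hn
  have h1 : (m / n : ℝ) ≤ Real.exp (m / n - 1) := by
    have := Real.add_one_le_exp (m / n - 1 : ℝ)
    linarith
  have h2 : (m / n : ℝ) ^ n ≤ S ^ (m - n) := by
    calc (m / n : ℝ) ^ n ≤ (Real.exp (m / n - 1)) ^ n :=
          pow_le_pow_left₀ (by positivity) h1 _
      _ = (Real.exp 1) ^ (m - n) := by
          rw [← Real.exp_nat_mul, ← Real.exp_nat_mul, Nat.cast_sub hnm]
          congr 1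
          field_simp
      _ ≤ S ^ (m - n) :=
          pow_le_pow_left₀ (Real.exp_pos _).le (Real.exp_one_lt_three.le.trans hS) _
  calc (m * S / n) ^ n = (m / n : ℝ) ^ n * S ^ n := by rw [← mul_pow]; congr 1; ring
    _ ≤ S ^ (m - n) * S ^ n := by gcongr
    _ = S ^ m := by rw [← pow_add, Nat.sub_add_cancel hnm]

/-- An upper bound for the norm of the value of an integer polynomial at a root of unity. -/
theorem sq_norm_aeval_primitiveRoot_le {f : ℕ} [NeZero f] {K : Type*} [Field K] [NumberField K]
    [IsCyclotomicExtension {f} ℚ K] {z : K} (hz : IsPrimitiveRoot z f) {h : ℤ[X]}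
    (hdeg : h.natDegree < f) (hsum : 3 ≤ ∑ i ∈ range f, h.coeff i ^ 2) :
    ((Algebra.norm ℚ (aeval z h) : ℚ) : ℝ) ^ 2 ≤
      ((∑ i ∈ range f, h.coeff i ^ 2 : ℤ) : ℝ) ^ f := by
  classical
  have hf : 0 < f := NeZero.pos f
  set S : ℝ := ((∑ i ∈ range f, h.coeff i ^ 2 : ℤ) : ℝ) with hSdef
  have hS : 3 ≤ S := by rw [hSdef]; exact_mod_cast hsum
  have hcard : #(univ : Finset (K →ₐ[ℚ] ℂ)) = f.totient := by
    rw [card_univ, AlgHom.card, IsCyclotomicExtension.Rat.finrank f K]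
  have hne : (univ : Finset (K →ₐ[ℚ] ℂ)).Nonempty := by
    rw [← card_pos, hcard]
    exact Nat.totient_pos.2 hf
  have hσ : ∀ σ : K →ₐ[ℚ] ℂ, σ (aeval z h) = aeval (σ z) h := fun σ =>
    (aeval_algHom_apply (σ.restrictScalars ℤ) z h).symm
  have hprod : ((Algebra.norm ℚ (aeval z h) : ℚ) : ℝ) ^ 2 =
      ∏ σ : K →ₐ[ℚ] ℂ, ‖aeval (σ z) h‖ ^ 2 := by
    have := congrArg (fun w : ℂ => ‖w‖ ^ 2) (Algebra.norm_eq_prod_embeddings ℚ ℂ (aeval z h))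
    simp only [norm_prod, hσ, ← prod_pow] at this
    rw [← this]
    simp [← sq_abs]
  obtain ⟨σ₀, -⟩ := hne
  have hζ : IsPrimitiveRoot (σ₀ z) f := hz.map_of_injective σ₀.injective
  have hsumle : ∑ σ : K →ₐ[ℚ] ℂ, ‖aeval (σ z) h‖ ^ 2 ≤ f * S := by
    rw [← sum_sq_norm_aeval_pow_primitiveRoot hf hdeg hζ]
    have hex : ∀ σ : K →ₐ[ℚ] ℂ, ∃ j < f, (σ₀ z) ^ j = σ z := fun σ =>
      hζ.eq_pow_of_pow_eq_one (by rw [← map_pow, hz.pow_eq_one, map_one])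
    choose j hj hjz using hex
    have hinj : Function.Injective j := by
      intro σ τ hst
      have : σ z = τ z := by rw [← hjz σ, ← hjz τ, hst]
      exact (hz.powerBasis ℚ).algHom_ext (by simpa using this)
    calc ∑ σ : K →ₐ[ℚ] ℂ, ‖aeval (σ z) h‖ ^ 2
        = ∑ i ∈ univ.image j, ‖aeval ((σ₀ z) ^ i) h‖ ^ 2 := by
          rw [sum_image fun _ _ _ _ e => hinj e]
          simp_rw [hjz]
      _ ≤ _ := by
          refine sum_le_sum_of_subset_of_nonneg ?_ fun _ _ _ => by positivity
          intro i hi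
          obtain ⟨σ, -, rfl⟩ := mem_image.1 hi
          exact mem_range.2 (hj σ)
  rw [hprod]
  calc ∏ σ : K →ₐ[ℚ] ℂ, ‖aeval (σ z) h‖ ^ 2
      ≤ ((∑ σ : K →ₐ[ℚ] ℂ, ‖aeval (σ z) h‖ ^ 2) / f.totient) ^ f.totient := by
        have := prod_le_sum_div_card_pow univ ⟨σ₀, mem_univ _⟩
          (fun σ : K →ₐ[ℚ] ℂ => ‖aeval (σ z) h‖ ^ 2) fun _ _ => by positivity
        rwa [hcard] at this
    _ ≤ (f * S / f.totient) ^ f.totient := by gcongr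
    _ ≤ S ^ f := mul_div_pow_le_pow (Nat.totient_pos.2 hf) (Nat.totient_le f) hS

/-- If `h` vanishes at an element `x` of order `f` of a finite field of characteristic `p`, then
the norm of `h(ζ_f)` is zero or at least `p ^ ord_f(p)`. -/
theorem pow_orderOf_le_norm_aeval {f : ℕ} [NeZero f] {K : Type*} [Field K] [NumberField K]
    [IsCyclotomicExtension {f} ℚ K] {z : K} (hz : IsPrimitiveRoot z f)
    {F : Type*} [Field F] [Fintype F] {p s : ℕ} (hp : p.Prime) (hq : Fintype.card F = p ^ s)
    {x : F} (hx : IsPrimitiveRoot x f) {h : ℤ[X]} (hroot : aeval x h = 0)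
    (hne : aeval z h ≠ 0) :
    (p : ℝ) ^ orderOf (p : ZMod f) ≤ |((Algebra.norm ℚ (aeval z h) : ℚ) : ℝ)| := by
  have hgen : hz.integralPowerBasis.gen = hz.toInteger := hz.integralPowerBasis_gen
  have hmin : aeval x (minpoly ℤ hz.integralPowerBasis.gen) = 0 := by
    rw [hgen, ← NumberField.RingOfIntegers.minpoly_coe,
      show (hz.toInteger : K) = z from rfl, ← cyclotomic_eq_minpoly hz (NeZero.pos f), aeval_def, eval₂_eq_eval_map,
      map_cyclotomic]
    exact hx.isRoot_cyclotomic (NeZero.pos f)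
  let φ : 𝓞 K →ₐ[ℤ] F := hz.integralPowerBasis.lift x hmin
  have hφ : φ hz.toInteger = x := by
    rw [← hgen]
    exact hz.integralPowerBasis.lift_gen x hmin
  set w : 𝓞 K := aeval hz.toInteger h with hw
  have hwz : (w : K) = aeval z h := by
    rw [hw]
    exact (aeval_algebraMap_apply K hz.toInteger h).symm
  have hker : Ideal.span {w} ≤ RingHom.ker (φ : 𝓞 K →+* F) := by
    rw [Ideal.span_singleton_le_iff_mem, RingHom.mem_ker]
    change φ w = 0
    rw [hw, ← aeval_algHom_apply, hφ, hroot]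
  have hw0 : w ≠ 0 := by
    intro h0
    rw [h0] at hwz
    exact hne (by simpa using hwz.symm)
  have hnorm : (Algebra.norm ℤ w) ≠ 0 := Algebra.norm_ne_zero_iff.2 hw0
  have hle : Nat.card (φ : 𝓞 K →+* F).range ≤ (Algebra.norm ℤ w).natAbs := by
    rw [← Ideal.absNorm_span_singleton,
      ← Nat.card_congr (RingHom.quotientKerEquivRange (φ : 𝓞 K →+* F)).toEquiv]
    refine Nat.le_of_dvd ?_ (Ideal.absNorm_dvd_absNorm_of_le hker)
    rw [Ideal.absNorm_span_singleton]
    exact Int.natAbs_pos.2 hnorm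
  have hpow := pow_orderOf_le_card_subring hp hq (φ : 𝓞 K →+* F).range
    (RingHom.mem_range.2 ⟨hz.toInteger, hφ⟩) (hx.ne_zero (NeZero.ne f))
  rw [← hx.eq_orderOf] at hpow
  have hcast : (Algebra.norm ℚ (aeval z h) : ℚ) = (Algebra.norm ℤ w : ℤ) := by
    rw [← hwz]
    exact (Algebra.coe_norm_int w).symm
  rw [hcast, Rat.cast_intCast, ← Int.cast_abs, Int.abs_eq_natAbs, Int.cast_natCast]
  exact_mod_cast hpow.trans hle

theorem aeval_primitiveRoot_eq_zero_iff {K : Type*} [Field K] [CharZero K] {f : ℕ} (hf : 0 < f)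
    {z : K} (hz : IsPrimitiveRoot z f) (h : ℤ[X]) : aeval z h = 0 ↔ cyclotomic f ℤ ∣ h := by
  rw [cyclotomic_eq_minpoly hz hf, minpoly.isIntegrallyClosed_dvd_iff (hz.isIntegral hf)]


/-- let `q = p^s` with `q - 1 = ef` (`e, f > 1`), `g` a generator of `F_q^*`,
and `h(x) = ∑_{i<f} aᵢ xⁱ ∈ ℤ[x]` with `∑ aᵢ² ≥ 3` and `p^(ord_f(p)) > (∑ aᵢ²)^(f/2)`.
Then `h(g^e) = 0` in `F_q` iff `h(ζ_f) = 0` in `ℂ` for a primitive `f`-th root of unity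
`ζ_f`. -/
theorem aeval_pow_eq_zero_iff_aeval_primitive_root_eq_zero
    {F : Type*} [Field F] [Fintype F] (p s e f : ℕ) (hp : p.Prime) (hs : 1 ≤ s)
    (hq : Fintype.card F = p ^ s)
    (he : 1 < e) (hf : 1 < f) (hef : p ^ s - 1 = e * f)
    (g : F) (hg : orderOf g = p ^ s - 1)
    (h : Polynomial ℤ) (hdeg : h.natDegree < f)
    (hsum : 3 ≤ ∑ i ∈ Finset.range f, (h.coeff i) ^ 2)
    (hbound : ((∑ i ∈ Finset.range f, (h.coeff i) ^ 2 : ℤ) : ℝ) ^ ((f : ℝ) / 2) <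
      (p : ℝ) ^ (orderOf (p : ZMod f)))
    (ζ : ℂ) (hζ : IsPrimitiveRoot ζ f) :
    Polynomial.aeval (g ^ e) h = 0 ↔ Polynomial.aeval ζ h = 0 := by
  have hf0 : 0 < f := by omega
  have : NeZero f := ⟨hf0.ne'⟩
  have hx : IsPrimitiveRoot (g ^ e) f :=
    IsPrimitiveRoot.pow (hg ▸ Nat.pos_of_ne_zero (by rw [hef]; positivity)) (IsPrimitiveRoot.orderOf g)
      (by rw [hg, hef])
  rw [aeval_primitiveRoot_eq_zero_iff hf0 hζ]
  constructor
  · intro hroot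
    have : NeZero ((f : ℕ) : ℚ) := ⟨Nat.cast_ne_zero.2 hf0.ne'⟩
    have : IsCyclotomicExtension {f} ℚ (CyclotomicField f ℚ) := by
      convert! CyclotomicField.isCyclotomicExtension f ℚ
    have hz := IsCyclotomicExtension.zeta_spec f ℚ (CyclotomicField f ℚ)
    rw [← aeval_primitiveRoot_eq_zero_iff hf0 hz]
    by_contra hne
    have hlow := pow_orderOf_le_norm_aeval hz hp hq hx hroot hne
    have hup := sq_norm_aeval_primitiveRoot_le hz hdeg hsum
    have hS : (0 : ℝ) ≤ ((∑ i ∈ Finset.range f, (h.coeff i) ^ 2 : ℤ) : ℝ) := by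
      exact_mod_cast (by norm_num : (0 : ℤ) ≤ 3).trans hsum
    have hlt := pow_lt_pow_left₀ (hbound.trans_le hlow) (Real.rpow_nonneg hS _) two_ne_zero
    rw [sq_abs, ← Real.rpow_mul_natCast hS, Nat.cast_ofNat, div_mul_cancel₀ _ two_ne_zero,
      Real.rpow_natCast] at hlt
    exact hlt.not_ge hup
  · rintro ⟨k, rfl⟩
    have : aeval (g ^ e) (cyclotomic f ℤ) = 0 := by
      rw [aeval_def, eval₂_eq_eval_map, map_cyclotomic]
      exact hx.isRoot_cyclotomic hf0
    rw [map_mul, this, zero_mul]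
end

section
/- Let q = p^s be a prime power with q − 1 = ef for integers e, f > 1, and let g be a generator of F_q^*. If f < log_{√14}( p^{ord_f(p)} ), then for all integers a, b with 0 ≤ a, b ≤ e − 1, the cyclotomic number (a, b) of order e satisfies (a, b) ≤ 2. -/
open NumberField

lemma sum_re_mul_add_im_mul {G : Type*} [CommGroup G] [Fintype G] (χ ψ : G →* ℂˣ)
    [Decidable (χ = ψ)] :
    ∑ g, ((χ g : ℂ).re * (ψ g : ℂ).re + (χ g : ℂ).im * (ψ g : ℂ).im) =
      if χ = ψ then (Fintype.card G : ℝ) else 0 := by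
  classical
  have hconj (g : G) : ((χ / ψ) g : ℂ) = (χ g : ℂ) * (starRingEnd ℂ) (ψ g : ℂ) := by
    have h1 : ‖(ψ g : ℂ)‖ = 1 := by
      apply Complex.norm_eq_one_of_pow_eq_one (n := Fintype.card G) _ Fintype.card_ne_zero
      rw [← Units.val_pow_eq_pow_val, ← map_pow, pow_card_eq_one, map_one, Units.val_one]
    rw [MonoidHom.div_apply, Units.val_div_eq_div_val, div_eq_mul_inv, Complex.inv_eq_conj h1]
  have h := sum_hom_units ((Units.coeHom ℂ).comp (χ / ψ))
  have h2 : (Units.coeHom ℂ).comp (χ / ψ) = 1 ↔ χ = ψ := by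
    rw [← div_eq_one (a := χ)]
    constructor
    · intro h
      ext g
      exact DFunLike.congr_fun h g
    · intro h
      rw [h]
      rfl
  have h3 := congrArg Complex.re h
  simp only [h2, MonoidHom.comp_apply, Units.coeHom_apply, hconj, Complex.re_sum,
    Complex.mul_re, Complex.conj_re, Complex.conj_im] at h3
  calc _ = ∑ g, ((χ g : ℂ).re * (ψ g : ℂ).re - (χ g : ℂ).im * -(ψ g : ℂ).im) := by
        refine Finset.sum_congr rfl fun g _ => by ring
    _ = _ := by
        rw [h3]
        split_ifs <;> simp

open scoped Classical in
lemma sum_norm_sq_sum_smul {G ι : Type*} [CommGroup G] [Fintype G] [Fintype ι]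
    (χ : ι → G →* ℂˣ) (c : ι → ℝ) :
    ∑ g, ‖∑ i, (c i : ℂ) * (χ i g : ℂ)‖ ^ 2 =
      Fintype.card G * ∑ i, ∑ j, c i * c j * (if χ i = χ j then 1 else 0) := by
  have h (g : G) : ‖∑ i, (c i : ℂ) * (χ i g : ℂ)‖ ^ 2 = ∑ i, ∑ j, c i * c j *
      ((χ i g : ℂ).re * (χ j g : ℂ).re + (χ i g : ℂ).im * (χ j g : ℂ).im) := by
    rw [Complex.sq_norm, Complex.normSq_apply, Complex.re_sum, Complex.im_sum,
      Finset.sum_mul_sum, Finset.sum_mul_sum, ← Finset.sum_add_distrib]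
    refine Finset.sum_congr rfl fun i _ => ?_
    rw [← Finset.sum_add_distrib]
    refine Finset.sum_congr rfl fun j _ => ?_
    simp only [Complex.re_ofReal_mul, Complex.im_ofReal_mul]
    ring
  simp_rw [h]
  rw [Finset.sum_comm, Finset.mul_sum]
  refine Finset.sum_congr rfl fun i _ => ?_
  rw [Finset.sum_comm, Finset.mul_sum]
  refine Finset.sum_congr rfl fun j _ => ?_
  rw [← Finset.mul_sum, sum_re_mul_add_im_mul]
  split_ifs <;> ring

lemma sum_norm_sq_sub_le {G : Type*} [CommGroup G] [Fintype G] (a b : Fin 3 → G →* ℂˣ)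
    (hab : ¬ ((a 0 = a 1 ∧ a 0 = a 2) ∧ (b 0 = b 1 ∧ b 0 = b 2))) :
    ∑ g, ‖((a 0 g : ℂ) + a 1 g + a 2 g) - (b 0 g + b 1 g + b 2 g)‖ ^ 2 ≤
      14 * Fintype.card G := by
  classical
  have h := sum_norm_sq_sum_smul (Fin.append a b) (Fin.append (fun _ => 1) (fun _ => -1))
  have hl (g : G) : ∑ i, ((Fin.append (fun _ : Fin 3 => 1) (fun _ : Fin 3 => -1) i : ℝ) : ℂ) *
      (Fin.append a b i g : ℂ) = (a 0 g + a 1 g + a 2 g) - (b 0 g + b 1 g + b 2 g) := by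
    rw [Fin.sum_univ_add]
    simp only [Fin.append_left, Fin.append_right, Fin.sum_univ_three]
    push_cast
    ring
  simp_rw [hl] at h
  rw [h, mul_comm]
  refine mul_le_mul_of_nonneg_right ?_ (Nat.cast_nonneg _)
  simp only [Fin.sum_univ_add, Fin.append_left, Fin.append_right]
  have hself (x : Fin 3 → G →* ℂˣ) :
      (∑ i, ∑ j, if x i = x j then (1 : ℝ) else 0) ≤ 9 ∧
      (¬ (x 0 = x 1 ∧ x 0 = x 2) → (∑ i, ∑ j, if x i = x j then (1 : ℝ) else 0) ≤ 5) := by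
    simp only [Fin.sum_univ_three, eq_comm (a := x 1) (b := x 0), eq_comm (a := x 2)]
    split_ifs <;> simp_all <;> norm_num
  have hcross (x y : Fin 3 → G →* ℂˣ) :
      (0 : ℝ) ≤ ∑ i, ∑ j, if x i = y j then (1 : ℝ) else 0 :=
    Finset.sum_nonneg fun i _ => Finset.sum_nonneg fun j _ => by split_ifs <;> norm_num
  simp only [Finset.sum_add_distrib, one_mul, neg_mul, mul_neg, neg_neg,
    Finset.sum_neg_distrib]
  have h1 := hself a
  have h2 := hself b
  have h3 := hcross a b
  have h4 := hcross b a
  by_cases ha : a 0 = a 1 ∧ a 0 = a 2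
  · have := h2.2 fun hb => hab ⟨ha, hb⟩
    linarith [h1.1]
  · linarith [h1.2 ha, h2.1]

lemma natAbs_norm_sq_le {K : Type*} [Field K] [NumberField K] (x : 𝓞 K) (c : ℝ) (hc : 3 ≤ c) (f : ℕ)
    (hf : Module.finrank ℚ K ≤ f) (hsum : ∑ σ : K →ₐ[ℚ] ℂ, ‖σ x‖ ^ 2 ≤ c * f) :
    ((Algebra.norm ℤ x).natAbs : ℝ) ^ 2 ≤ c ^ f := by
  have hnorm : ((Algebra.norm ℤ x).natAbs : ℝ) = ∏ σ : K →ₐ[ℚ] ℂ, ‖σ x‖ := by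
    rw [← norm_prod, ← Algebra.norm_eq_prod_embeddings ℚ ℂ (x : K), ← Algebra.coe_norm_int,
      eq_ratCast, Rat.cast_intCast, Complex.norm_intCast, Nat.cast_natAbs, Int.cast_abs]
  have hc0 : 0 < c := by linarith
  set n := Module.finrank ℚ K with hn
  have hcard : (Finset.univ : Finset (K →ₐ[ℚ] ℂ)).card = n := by
    rw [Finset.card_univ, AlgHom.card]
  have hexp : Real.exp 1 ≤ c := by linarith [Real.exp_one_lt_d9]
  rw [hnorm, ← Finset.prod_pow]
  calc ∏ σ : K →ₐ[ℚ] ℂ, ‖σ x‖ ^ 2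
      ≤ ∏ σ : K →ₐ[ℚ] ℂ, (c * Real.exp (‖σ x‖ ^ 2 / c - 1)) := by
        refine Finset.prod_le_prod (fun _ _ => by positivity) fun σ _ => ?_
        have := Real.add_one_le_exp (‖σ x‖ ^ 2 / c - 1)
        rw [← div_le_iff₀' hc0]
        linarith
    _ = c ^ n * Real.exp ((∑ σ : K →ₐ[ℚ] ℂ, ‖σ x‖ ^ 2) / c - n) := by
        rw [Finset.prod_mul_distrib, Finset.prod_const, hcard, ← Real.exp_sum,
          Finset.sum_sub_distrib, Finset.sum_div, Finset.sum_const, hcard, nsmul_one]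
    _ ≤ c ^ n * Real.exp ((f - n : ℕ) : ℝ) := by
        gcongr
        rw [Nat.cast_sub hf]
        gcongr
        rw [div_le_iff₀' hc0]
        exact hsum
    _ ≤ c ^ n * c ^ (f - n) := by
        gcongr
        rw [← Real.exp_one_pow]
        gcongr
    _ = c ^ f := by rw [← pow_add, Nat.add_sub_cancel' hf]

lemma pow_orderOf_le_card {k : Type*} [Field k] [Fintype k] (p : ℕ) [CharP k p] {f : ℕ}
    (hf : f ≠ 0) {ζ : k} (hζ : IsPrimitiveRoot ζ f) : p ^ orderOf (p : ZMod f) ≤ Fintype.card k := by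
  obtain ⟨n, hp, hn⟩ := FiniteField.card k p
  have h0 : ζ ≠ 0 := hζ.ne_zero hf
  have h1 : f ∣ Fintype.card k - 1 :=
    hζ.dvd_of_pow_eq_one _ (FiniteField.pow_card_sub_one_eq_one ζ h0)
  have h2 : (p : ZMod f) ^ (n : ℕ) = 1 := by
    rw [← Nat.cast_pow, ← hn, ← Nat.cast_one, ZMod.natCast_eq_natCast_iff]
    exact ((Nat.modEq_iff_dvd' Fintype.card_pos).2 h1).symm
  rw [hn]
  exact Nat.pow_le_pow_right hp.pos (Nat.le_of_dvd n.pos (orderOf_dvd_of_pow_eq_one h2))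

lemma pow_orderOf_le_natAbs_norm {K F : Type*} [Field K] [NumberField K] [Field F] [Finite F]
    (p : ℕ) [CharP F p] {f : ℕ} (hf : f ≠ 0) (φ : 𝓞 K →+* F) {ζ : 𝓞 K}
    (hζ : IsPrimitiveRoot (φ ζ) f)
    {x : 𝓞 K} (hx : x ≠ 0) (hφx : φ x = 0) :
    p ^ orderOf (p : ZMod f) ≤ (Algebra.norm ℤ x).natAbs := by
  have hker : Ideal.span {x} ≤ RingHom.ker φ := by
    rwa [Ideal.span_singleton_le_iff_mem, RingHom.mem_ker]
  have hdvd := Ideal.absNorm_dvd_absNorm_of_le hker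
  rw [Ideal.absNorm_span_singleton] at hdvd
  have hpos : 0 < (Algebra.norm ℤ x).natAbs := by
    rw [Int.natAbs_pos]
    exact Algebra.norm_ne_zero_iff.2 hx
  refine le_trans ?_ (Nat.le_of_dvd hpos hdvd)
  classical
  let _ : Fintype φ.range := Fintype.ofFinite _
  let _ : Field φ.range := Fintype.fieldOfDomain _
  have hcard : Ideal.absNorm (RingHom.ker φ) = Fintype.card φ.range := by
    rw [Ideal.absNorm_apply, Submodule.cardQuot_apply, ← Nat.card_eq_fintype_card]
    exact Nat.card_congr (RingHom.quotientKerEquivRange φ).toEquiv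
  rw [hcard]
  have : CharP φ.range p := (φ.range.subtype).charP Subtype.val_injective p
  exact pow_orderOf_le_card p hf (ζ := φ.rangeRestrict ζ)
    (IsPrimitiveRoot.of_map_of_injective (f := φ.range.subtype) hζ Subtype.val_injective)

lemma modEq_of_pow_eq_pow {M : Type*} [CommMonoid M] {f : ℕ} [NeZero f] {ζ : M}
    (hζ : IsPrimitiveRoot ζ f) {k l : ℕ} (h : ζ ^ k = ζ ^ l) : k ≡ l [MOD f] := by
  rw [pow_eq_pow_mod k hζ.pow_eq_one, pow_eq_pow_mod l hζ.pow_eq_one] at h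
  exact hζ.pow_inj (Nat.mod_lt _ (NeZero.pos f)) (Nat.mod_lt _ (NeZero.pos f)) h

lemma exists_ringHom_toInteger_eq {f : ℕ} [NeZero f] {K F : Type*} [Field K] [NumberField K]
    [IsCyclotomicExtension {f} ℚ K] [Field F] {ζ : K} (hζ : IsPrimitiveRoot ζ f) {h : F}
    (hh : IsPrimitiveRoot h f) : ∃ φ : 𝓞 K →+* F, φ hζ.toInteger = h := by
  have hroot : Polynomial.aeval h (minpoly ℤ hζ.integralPowerBasis.gen) = 0 := by
    have h1 : minpoly ℤ hζ.integralPowerBasis.gen = Polynomial.cyclotomic f ℤ := by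
      rw [hζ.integralPowerBasis_gen, ← RingOfIntegers.minpoly_coe]
      exact (Polynomial.cyclotomic_eq_minpoly hζ (NeZero.pos f)).symm
    rw [h1, Polynomial.aeval_def, Polynomial.eval₂_eq_eval_map, Polynomial.map_cyclotomic]
    exact hh.isRoot_cyclotomic (NeZero.pos f)
  refine ⟨(hζ.integralPowerBasis.lift h hroot : 𝓞 K →ₐ[ℤ] F), ?_⟩
  have := hζ.integralPowerBasis.lift_gen h hroot
  rwa [hζ.integralPowerBasis_gen] at this

lemma sum_embeddings_norm_sq_le {f : ℕ} [NeZero f] {K : Type*} [Field K] [NumberField K]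
    [IsCyclotomicExtension {f} ℚ K] {ζ : K} (hζ : IsPrimitiveRoot ζ f) (m n : Fin 3 → ℕ)
    (hmn : ¬ ((m 0 ≡ m 1 [MOD f] ∧ m 0 ≡ m 2 [MOD f]) ∧
      (n 0 ≡ n 1 [MOD f] ∧ n 0 ≡ n 2 [MOD f]))) :
    ∑ σ : K →ₐ[ℚ] ℂ,
      ‖σ ((ζ ^ m 0 + ζ ^ m 1 + ζ ^ m 2) - (ζ ^ n 0 + ζ ^ n 1 + ζ ^ n 2))‖ ^ 2 ≤ 14 * f := by
  let χ : ℕ → rootsOfUnity f ℂ →* ℂˣ := fun k => (powMonoidHom k).comp (Subgroup.subtype _)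
  have hχ {k l : ℕ} (h : χ k = χ l) : k ≡ l [MOD f] := by
    have hω := Complex.isPrimitiveRoot_exp f (NeZero.ne f)
    have hω' : IsPrimitiveRoot (hω.toRootsOfUnity : ℂˣ) f := IsPrimitiveRoot.coe_units_iff.1 hω
    have h1 : (hω.toRootsOfUnity : ℂˣ) ^ k = (hω.toRootsOfUnity : ℂˣ) ^ l :=
      DFunLike.congr_fun h hω.toRootsOfUnity
    exact modEq_of_pow_eq_pow hω' h1
  let _ : Fintype (rootsOfUnity f ℂ) := Fintype.ofFinite _
  have hsum := sum_norm_sq_sub_le (fun i => χ (m i)) (fun i => χ (n i)) fun h =>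
    hmn ⟨⟨hχ h.1.1, hχ h.1.2⟩, hχ h.2.1, hχ h.2.2⟩
  rw [← Nat.card_eq_fintype_card, Complex.card_rootsOfUnity] at hsum
  refine le_trans ?_ hsum
  let e : (K →ₐ[ℚ] ℂ) → rootsOfUnity f ℂ := fun σ =>
    (hζ.map_of_injective σ.injective).toRootsOfUnity
  have he : Function.Injective e := by
    intro σ τ h
    apply (hζ.powerBasis ℚ).algHom_ext
    rw [hζ.powerBasis_gen ℚ]
    exact congrArg (fun u : rootsOfUnity f ℂ => ((u : ℂˣ) : ℂ)) h
  let Φ : rootsOfUnity f ℂ → ℝ := fun g => ‖((χ (m 0) g : ℂ) + χ (m 1) g + χ (m 2) g) -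
    (χ (n 0) g + χ (n 1) g + χ (n 2) g)‖ ^ 2
  calc _ = ∑ σ, Φ (e σ) := by
        refine Finset.sum_congr rfl fun σ _ => ?_
        simp [Φ, χ, e]
    _ = ∑ g ∈ Finset.univ.map ⟨e, he⟩, Φ g := by rw [Finset.sum_map]; rfl
    _ ≤ _ := Finset.sum_le_univ_sum_of_nonneg fun _ => by positivity

lemma mul_eq_mul_of_collinear {x₁ x₂ x₃ y₁ y₂ y₃ : ℂ} (hx₁ : ‖x₁‖ = 1) (hx₂ : ‖x₂‖ = 1)
    (hx₃ : ‖x₃‖ = 1) (hy₁ : ‖y₁‖ = 1) (hy₂ : ‖y₂‖ = 1) (hy₃ : ‖y₃‖ = 1) (hx₁₂ : x₁ ≠ x₂)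
    (hy₁₃ : y₁ ≠ y₃) (hy₂₃ : y₂ ≠ y₃)
    (h : (x₂ * y₃ + x₁ * y₂ + x₃ * y₁) - (x₂ * y₁ + x₁ * y₃ + x₃ * y₂) = 0) :
    x₂ * y₁ = x₁ * y₂ := by
  have hdet : (x₂ - x₁) * (y₃ - y₁) = (y₂ - y₁) * (x₃ - x₁) := by linear_combination h
  have hconj := congrArg (starRingEnd ℂ) hdet
  simp only [map_mul, map_sub] at hconj
  rw [← Complex.inv_eq_conj hx₁, ← Complex.inv_eq_conj hx₂, ← Complex.inv_eq_conj hx₃,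
    ← Complex.inv_eq_conj hy₁, ← Complex.inv_eq_conj hy₂, ← Complex.inv_eq_conj hy₃] at hconj
  have hne {z : ℂ} (hz : ‖z‖ = 1) : z ≠ 0 := norm_ne_zero_iff.1 (by simp [hz])
  have hx₁0 := hne hx₁
  have hx₂0 := hne hx₂
  have hx₃0 := hne hx₃
  have hy₁0 := hne hy₁
  have hy₂0 := hne hy₂
  have hy₃0 := hne hy₃
  field_simp at hconj
  have h23 : x₂ * y₃ = y₂ * x₃ := by
    have h0 : (x₂ - x₁) * (y₃ - y₁) ≠ 0 := mul_ne_zero (sub_ne_zero.2 hx₁₂.symm)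
      (sub_ne_zero.2 hy₁₃.symm)
    apply mul_left_cancel₀ h0
    linear_combination (x₂ * y₃) * hdet - hconj
  have hprod : x₁ * ((x₂ * y₁ - x₁ * y₂) * (y₂ - y₃)) = 0 := by
    linear_combination -x₁ * y₂ * (h - h23) - x₁ * y₁ * h23
  simpa [hx₁0, sub_ne_zero.2 hy₂₃, sub_eq_zero] using hprod

lemma false_of_products_eq {F : Type*} [Field F] {x₁ x₂ x₃ y₁ y₂ y₃ : F} (hx₁ : x₁ ≠ 0) (hx₂ : x₂ ≠ 0)
    (hx₃ : x₃ ≠ 0) (hy₁₂ : y₁ ≠ y₂) (hy₁₃ : y₁ ≠ y₃)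
    (h : (x₂ * y₃ + x₁ * y₂ + x₃ * y₁) - (x₂ * y₁ + x₁ * y₃ + x₃ * y₂) = 0)
    (h₁ : x₂ * y₃ = x₁ * y₂) (h₂ : x₂ * y₃ = x₃ * y₁) (h₃ : x₂ * y₁ = x₁ * y₃)
    (h₄ : x₂ * y₁ = x₃ * y₂) : False := by
  have h3 : (3 : F) = 0 := by
    have : x₂ * (y₃ - y₁) * 3 = 0 := by linear_combination h + h₁ + h₂ - h₃ - h₄
    simpa [hx₂, sub_ne_zero.2 hy₁₃.symm] using this
  have e₁ : y₁ ^ 2 = y₂ * y₃ := by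
    apply mul_left_cancel₀ (mul_ne_zero hx₂ hx₃)
    linear_combination -x₂ * y₁ * h₂ + x₂ * y₃ * h₄
  have e₂ : y₂ ^ 2 = y₁ * y₃ := by
    apply mul_left_cancel₀ (mul_ne_zero hx₁ hx₃)
    linear_combination x₃ * y₂ * (h₂ - h₁) + x₃ * y₁ * (h₃ - h₄)
  have : (y₁ - y₂) ^ 3 = 0 := by
    linear_combination y₁ * e₁ - y₂ * e₂ + y₁ * y₂ * (y₂ - y₁) * h3
  exact hy₁₂ (sub_eq_zero.1 (pow_eq_zero_iff (by norm_num) |>.1 this))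

lemma false_of_three_solutions {F : Type*} [Field F] [Finite F] (p : ℕ) [CharP F p] {f : ℕ}
    [NeZero f] (K : Type*) [Field K] [NumberField K] [IsCyclotomicExtension {f} ℚ K] {h : F} (hh : IsPrimitiveRoot h f)
    (hp : (14 : ℝ) ^ f < ((p : ℝ) ^ orderOf (p : ZMod f)) ^ 2) {A B : F} {i j : Fin 3 → ℕ}
    (hAB : ∀ k, 1 + A * h ^ i k = B * h ^ j k) (hi : Function.Injective fun k => h ^ i k)
    (hj : Function.Injective fun k => h ^ j k) : False := by
  have hh0 : h ≠ 0 := hh.ne_zero (NeZero.ne f)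
  have hj01 : h ^ j 0 ≠ h ^ j 1 := hj.ne (by decide)
  have hj02 : h ^ j 0 ≠ h ^ j 2 := hj.ne (by decide)
  have hdet : (h ^ i 1 * h ^ j 2 + h ^ i 0 * h ^ j 1 + h ^ i 2 * h ^ j 0) -
      (h ^ i 1 * h ^ j 0 + h ^ i 0 * h ^ j 2 + h ^ i 2 * h ^ j 1) = 0 := by
    linear_combination (h ^ i 1 * h ^ j 2 - h ^ i 2 * h ^ j 1) * hAB 0 +
      (h ^ i 2 * h ^ j 0 - h ^ i 0 * h ^ j 2) * hAB 1 +
      (h ^ i 0 * h ^ j 1 - h ^ i 1 * h ^ j 0) * hAB 2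
  have hζ := IsCyclotomicExtension.zeta_spec f ℚ K
  set ζ := IsCyclotomicExtension.zeta f ℚ K
  obtain ⟨φ, hφ⟩ := exists_ringHom_toInteger_eq hζ hh
  let m : Fin 3 → ℕ := ![i 1 + j 2, i 0 + j 1, i 2 + j 0]
  let n : Fin 3 → ℕ := ![i 1 + j 0, i 0 + j 2, i 2 + j 1]
  let x : 𝓞 K := (hζ.toInteger ^ m 0 + hζ.toInteger ^ m 1 + hζ.toInteger ^ m 2) -
    (hζ.toInteger ^ n 0 + hζ.toInteger ^ n 1 + hζ.toInteger ^ n 2)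
  have hx : (x : K) = (ζ ^ m 0 + ζ ^ m 1 + ζ ^ m 2) - (ζ ^ n 0 + ζ ^ n 1 + ζ ^ n 2) := by
    simp only [x, map_sub, map_add, map_pow]
    rfl
  have hφx : φ x = 0 := by
    simp only [x, map_sub, map_add, map_pow, hφ, ← hdet]
    simp [m, n, pow_add]
  have hmod {k l : ℕ} (hkl : k ≡ l [MOD f]) : h ^ k = h ^ l :=
    pow_eq_pow_of_modEq hkl hh.pow_eq_one
  have hmn : ¬ ((m 0 ≡ m 1 [MOD f] ∧ m 0 ≡ m 2 [MOD f]) ∧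
      (n 0 ≡ n 1 [MOD f] ∧ n 0 ≡ n 2 [MOD f])) := by
    rintro ⟨⟨h₁, h₂⟩, h₃, h₄⟩
    have h₁ := hmod h₁
    have h₂ := hmod h₂
    have h₃ := hmod h₃
    have h₄ := hmod h₄
    simp only [m, n, Matrix.cons_val, pow_add] at h₁ h₂ h₃ h₄
    exact false_of_products_eq (pow_ne_zero _ hh0) (pow_ne_zero _ hh0) (pow_ne_zero _ hh0)
      hj01 hj02 hdet h₁ h₂ h₃ h₄
  have hx0 : x ≠ 0 := by
    intro hx0
    let σ : K →ₐ[ℚ] ℂ := IsAlgClosed.lift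
    have hω : IsPrimitiveRoot (σ ζ) f := hζ.map_of_injective σ.injective
    have hω1 (k : ℕ) : ‖(σ ζ) ^ k‖ = 1 := by
      rw [norm_pow, Complex.norm_eq_one_of_pow_eq_one hω.pow_eq_one (NeZero.ne f), one_pow]
    have hωmod {k l : ℕ} (hkl : (σ ζ) ^ k = (σ ζ) ^ l) : h ^ k = h ^ l :=
      hmod (modEq_of_pow_eq_pow hω hkl)
    have hωne {a : Fin 3 → ℕ} (ha : Function.Injective fun k => h ^ a k) {k l : Fin 3}
        (hkl : k ≠ l) : (σ ζ) ^ a k ≠ (σ ζ) ^ a l := fun h => hkl (ha (hωmod h))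
    have hdetω : ((σ ζ) ^ i 1 * (σ ζ) ^ j 2 + (σ ζ) ^ i 0 * (σ ζ) ^ j 1 +
        (σ ζ) ^ i 2 * (σ ζ) ^ j 0) - ((σ ζ) ^ i 1 * (σ ζ) ^ j 0 +
        (σ ζ) ^ i 0 * (σ ζ) ^ j 2 + (σ ζ) ^ i 2 * (σ ζ) ^ j 1) = 0 := by
      have := congrArg σ hx
      rw [hx0] at this
      simpa [m, n, pow_add] using this.symm
    have key := mul_eq_mul_of_collinear (hω1 _) (hω1 _) (hω1 _) (hω1 _) (hω1 _) (hω1 _)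
      (hωne hi (by decide)) (hωne hj (by decide)) (hωne hj (by decide)) hdetω
    rw [← pow_add, ← pow_add] at key
    have key := hωmod key
    rw [pow_add, pow_add] at key
    apply hj01
    linear_combination h ^ j 0 * hAB 1 - h ^ j 1 * hAB 0 - A * key
  have hlow : ((p : ℝ) ^ orderOf (p : ZMod f)) ≤ ((Algebra.norm ℤ x).natAbs : ℝ) := by
    exact_mod_cast pow_orderOf_le_natAbs_norm p (NeZero.ne f) φ (ζ := hζ.toInteger)
      (hφ.symm ▸ hh) hx0 hφx
  have hup := natAbs_norm_sq_le x 14 (by norm_num) f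
    (by rw [IsCyclotomicExtension.Rat.finrank f K]; exact Nat.totient_le f)
    (by rw [hx]; exact sum_embeddings_norm_sq_le hζ m n hmn)
  have := pow_le_pow_left₀ (by positivity) hlow 2
  linarith

/-- let `q = p^s` with `q - 1 = ef` (`e, f > 1`) and `g` a generator of
`F_q^*`. If `f < log_{√14}(p^(ord_f(p)))`, then every cyclotomic number `(a, b)` of order
`e` with `0 ≤ a, b ≤ e - 1` is at most `2`; here `(a, b)` is the number of pairs
`(i, j) ∈ {0, …, f-1}²` with `1 + g^(a + ie) = g^(b + je)`. -/
theorem cyclotomic_numbers_le_two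
    {F : Type*} [Field F] [Fintype F] (p s e f : ℕ) (hp : p.Prime) (hs : 1 ≤ s)
    (hq : Fintype.card F = p ^ s)
    (he : 1 < e) (hf : 1 < f) (hef : p ^ s - 1 = e * f)
    (g : F) (hg : orderOf g = p ^ s - 1)
    (hflog : (f : ℝ) < Real.logb (Real.sqrt 14) ((p : ℝ) ^ orderOf (p : ZMod f))) :
    ∀ a b : ℕ, a ≤ e - 1 → b ≤ e - 1 →
      Nat.card {ij : Fin f × Fin f //
        (1 : F) + g ^ (a + (ij.1 : ℕ) * e) = g ^ (b + (ij.2 : ℕ) * e)} ≤ 2 := by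
  classical
  intro a b _ _
  have : Fact p.Prime := ⟨hp⟩
  have : CharP F p := charP_of_card_eq_prime_pow hq
  have : NeZero f := ⟨by omega⟩
  have : IsCyclotomicExtension {f} ℚ (CyclotomicField f ℚ) := by
    convert CyclotomicField.isCyclotomicExtension f ℚ
    · rfl
    · exact Subsingleton.elim _ _
  have hh : IsPrimitiveRoot (g ^ e) f :=
    (hg ▸ IsPrimitiveRoot.orderOf g).pow (by rw [hef]; positivity) hef
  have hg0 : g ≠ 0 := by
    rintro rfl
    exact hh.ne_zero (by omega) (zero_pow (by omega))
  have h14 : (14 : ℝ) ^ f < ((p : ℝ) ^ orderOf (p : ZMod f)) ^ 2 := by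
    have hb : 1 < Real.sqrt 14 := Real.lt_sqrt_of_sq_lt (by norm_num)
    rw [Real.lt_logb_iff_rpow_lt hb (pow_pos (mod_cast hp.pos) _), Real.rpow_natCast] at hflog
    calc (14 : ℝ) ^ f = (Real.sqrt 14 ^ f) ^ 2 := by
          rw [← pow_mul, mul_comm, pow_mul, Real.sq_sqrt (by norm_num)]
      _ < _ := by gcongr
  rw [Nat.card_eq_fintype_card]
  by_contra! hcard
  obtain ⟨u, v, w, huv, huw, hvw⟩ := Fintype.two_lt_card_iff.1 hcard
  let t : Fin 3 → Fin f × Fin f := ![u, v, w]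
  have ht : ∀ k, (1 : F) + g ^ a * (g ^ e) ^ ((t k).1 : ℕ) =
      g ^ b * (g ^ e) ^ ((t k).2 : ℕ) := by
    have (y : {ij : Fin f × Fin f //
        (1 : F) + g ^ (a + (ij.1 : ℕ) * e) = g ^ (b + (ij.2 : ℕ) * e)}) :
        (1 : F) + g ^ a * (g ^ e) ^ (y.1.1 : ℕ) = g ^ b * (g ^ e) ^ (y.1.2 : ℕ) := by
      simpa only [pow_add, mul_comm _ e, pow_mul] using y.2
    intro k
    fin_cases k
    exacts [this u, this v, this w]
  have htinj : Function.Injective t := by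
    rw [← Subtype.coe_ne_coe] at huv huw hvw
    intro k l hkl
    fin_cases k <;> fin_cases l <;> simp_all [t]
  have hpow {k l : Fin f} (hkl : (g ^ e) ^ (k : ℕ) = (g ^ e) ^ (l : ℕ)) : k = l :=
    Fin.ext (hh.pow_inj k.2 l.2 hkl)
  refine false_of_three_solutions p (CyclotomicField f ℚ) hh h14 ht ?_ ?_
  · intro k l hkl
    refine htinj (Prod.ext (hpow hkl) (hpow ?_))
    apply mul_left_cancel₀ (pow_ne_zero b hg0)
    rw [← ht, ← ht]
    exact congrArg (fun y => 1 + g ^ a * y) hkl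
  · intro k l hkl
    refine htinj (Prod.ext (hpow ?_) (hpow hkl))
    apply mul_left_cancel₀ (pow_ne_zero a hg0)
    apply add_left_cancel (a := (1 : F))
    rw [ht, ht]
    exact congrArg (fun y => g ^ b * y) hkl
end

section
/- Let q = p^s be a prime power with q − 1 = ef for integers e, f > 1, and let g be a generator of F_q^*. Suppose f < log_{√14}( p^{ord_f(p)} ). Let S' = {1, g^e, g^{2e}, …, g^{(f−1)e}} be the subgroup of F_q^* of order f. Then for every δ ∈ F_q and every γ ∈ F_q with γ ≠ 0, one has |δS' ∩ (S' + γ)| ≤ 2, where δS' = {δs : s ∈ S'} and S' + γ = {s + γ : s ∈ S'}. -/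
open Pointwise
open NumberField Polynomial

/-- A subring of a finite field of characteristic `p` containing an element of order `f` has at
least `p ^ ord_f(p)` elements. -/
theorem pow_orderOf_le_card_range {F R : Type*} [Field F] [Finite F] [CommRing R] (p s f : ℕ)
    (hp : p.Prime) (hq : Nat.card F = p ^ s) (φ : R →+* F) (z : R)
    (hz : orderOf (φ z) = f) (hf : 0 < f) :
    p ^ orderOf (p : ZMod f) ≤ Nat.card φ.range := by
  obtain ⟨m, -, hm⟩ : ∃ m ≤ s, Nat.card φ.range = p ^ m := by
    rw [← Nat.dvd_prime_pow hp, ← hq]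
    exact φ.range.toAddSubgroup.card_addSubgroup_dvd_card
  have hm0 : 0 < m := by
    rcases Nat.eq_zero_or_pos m with rfl | h
    · have := Finite.one_lt_card (α := φ.range)
      rw [hm, pow_zero] at this
      omega
    · exact h
  have : Fintype φ.range := Fintype.ofFinite _
  have hfd : f ∣ p ^ m - 1 := by
    classical
    let _ : Field φ.range := Fintype.fieldOfDomain _
    have hne : (⟨φ z, z, rfl⟩ : φ.range) ≠ 0 := by
      intro h
      have h0 : φ z = 0 := congrArg Subtype.val h
      rw [h0, orderOf_zero] at hz
      omega
    have h1 := FiniteField.pow_card_sub_one_eq_one _ hne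
    rw [← Nat.card_eq_fintype_card, hm] at h1
    rw [← hz]
    exact orderOf_dvd_of_pow_eq_one (congrArg Subtype.val h1)
  have h1 : (p : ZMod f) ^ m = 1 := by
    have h2 := (ZMod.natCast_eq_zero_iff _ _).2 hfd
    rw [Nat.cast_sub (Nat.one_le_pow _ _ hp.pos)] at h2
    push_cast at h2
    exact sub_eq_zero.1 h2
  rw [hm]
  exact Nat.pow_le_pow_right hp.pos (Nat.le_of_dvd hm0 (orderOf_dvd_of_pow_eq_one h1))

/-- If an integer polynomial vanishes at an element `h` of order `f` of a finite field of
characteristic `p`, but not at the complex primitive `f`-th roots of unity, then the product of its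
values at the latter is at least `p ^ ord_f(p)` in absolute value. -/
theorem pow_orderOf_le_prod_primitiveRoots {F : Type*} (K : Type*) [Field F] [Finite F]
    [Field K] [NumberField K] (p s f : ℕ) [IsCyclotomicExtension {f} ℚ K]
    (hp : p.Prime) (hq : Nat.card F = p ^ s) (hf : 0 < f) (h : F) (hh : IsPrimitiveRoot h f)
    (T : ℤ[X]) (hT : aeval h T = 0) (ω : ℂ) (hω : IsPrimitiveRoot ω f) (hTω : aeval ω T ≠ 0) :
    (p : ℝ) ^ orderOf (p : ZMod f) ≤ ∏ z ∈ primitiveRoots f ℂ, ‖aeval z T‖ := by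
  have : NeZero f := ⟨hf.ne'⟩
  have hζ : IsPrimitiveRoot (IsCyclotomicExtension.zeta f ℚ K) f :=
    IsCyclotomicExtension.zeta_spec f ℚ K
  have hmin : minpoly ℤ hζ.integralPowerBasis.gen = cyclotomic f ℤ := by
    rw [hζ.integralPowerBasis_gen, ← NumberField.RingOfIntegers.minpoly_coe]
    exact (cyclotomic_eq_minpoly hζ hf).symm
  have hroot : aeval h (minpoly ℤ hζ.integralPowerBasis.gen) = 0 := by
    rw [hmin, aeval_def, eval₂_eq_eval_map, map_cyclotomic]
    exact hh.isRoot_cyclotomic hf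
  let φ : 𝓞 K →ₐ[ℤ] F := hζ.integralPowerBasis.lift h hroot
  have hφ : φ hζ.toInteger = h := by
    rw [← hζ.integralPowerBasis_gen]
    exact PowerBasis.lift_gen _ _ _
  set α : 𝓞 K := aeval hζ.toInteger T with hα
  have hcoe (σ : K →ₐ[ℚ] ℂ) :
      σ (α : K) = aeval (σ (IsCyclotomicExtension.zeta f ℚ K)) T := by
    have h1 : (α : K) = aeval (IsCyclotomicExtension.zeta f ℚ K) T :=
      (aeval_algebraMap_apply K hζ.toInteger T).symm
    rw [h1]
    exact (aeval_algHom_apply (σ.restrictScalars ℤ) _ T).symm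
  let E := hζ.embeddingsEquivPrimitiveRoots ℂ (cyclotomic.irreducible_rat hf)
  have hE (σ : K →ₐ[ℚ] ℂ) :
      (E σ : ℂ) = σ (IsCyclotomicExtension.zeta f ℚ K) := rfl
  have hα0 : α ≠ 0 := by
    intro h0
    have h1 := hcoe (E.symm ⟨ω, (mem_primitiveRoots hf).2 hω⟩)
    rw [← hE, Equiv.apply_symm_apply, h0] at h1
    exact hTω (by simpa using h1.symm)
  have hker : Ideal.span {α} ≤ RingHom.ker φ.toRingHom := by
    rw [Ideal.span_singleton_le_iff_mem, RingHom.mem_ker]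
    change φ α = 0
    rw [hα, ← aeval_algHom_apply, hφ, hT]
  have hnorm : p ^ orderOf (p : ZMod f) ≤ (Algebra.norm ℤ α).natAbs := by
    have h1 := pow_orderOf_le_card_range p s f hp hq φ.toRingHom hζ.toInteger
      (by change orderOf (φ _) = f; rw [hφ]; exact hh.eq_orderOf.symm) hf
    rw [← Nat.card_congr (RingHom.quotientKerEquivRange φ.toRingHom).toEquiv] at h1
    refine h1.trans ?_
    rw [← Ideal.absNorm_span_singleton]
    refine Nat.le_of_dvd ?_ (Ideal.absNorm_dvd_absNorm_of_le hker)
    rw [Ideal.absNorm_span_singleton]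
    exact Int.natAbs_pos.2 (Algebra.norm_ne_zero_iff.2 hα0)
  have hprod : ((Algebra.norm ℤ α).natAbs : ℝ) = ∏ z ∈ primitiveRoots f ℂ, ‖aeval z T‖ := by
    have h1 := Algebra.norm_eq_prod_embeddings ℚ ℂ (α : K)
    rw [← Algebra.coe_norm_int] at h1
    have h2 := congrArg norm h1
    rw [norm_prod] at h2
    rw [← Finset.prod_coe_sort, ← E.prod_comp]
    simp only [hcoe] at h2
    simp only [hE]
    rw [← h2]
    simp [Nat.cast_natAbs]
  rw [← hprod]
  exact_mod_cast hnorm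

/-- Orthogonality of the powers of two `f`-th roots of unity. -/
theorem sum_pow_mul_conj_pow (f : ℕ) (u v : ℂ) (hu : u ^ f = 1) (hv : v ^ f = 1)
    (hv1 : ‖v‖ = 1) :
    ∑ j ∈ Finset.range f, u ^ j * (starRingEnd ℂ) (v ^ j) = if u = v then (f : ℂ) else 0 := by
  have hv0 : v ≠ 0 := by
    rintro rfl
    simp at hv1
  have hc : (starRingEnd ℂ) v = v⁻¹ := (Complex.inv_eq_conj hv1).symm
  have h1 : ∀ j, u ^ j * (starRingEnd ℂ) (v ^ j) = (u / v) ^ j := by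
    intro j
    rw [map_pow, hc, div_eq_mul_inv, mul_pow]
  simp only [h1]
  split_ifs with h
  · simp [h, div_self hv0]
  · have h2 : u / v ≠ 1 := fun h3 => h ((div_eq_one_iff_eq hv0).1 h3)
    rw [geom_sum_eq h2, div_pow, hu, hv]
    simp

/-- Parseval's identity for a real combination of `f`-th roots of unity. -/
theorem sum_norm_sq_eq {ι : Type*} [Fintype ι] (f : ℕ) (hf : f ≠ 0) (c : ι → ℝ) (w : ι → ℂ)
    (hw : ∀ i, w i ^ f = 1) :
    ∑ j ∈ Finset.range f, ‖∑ i, (c i : ℂ) * w i ^ j‖ ^ 2 =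
      f * ∑ i, ∑ k, c i * c k * if w i = w k then 1 else 0 := by
  have h1 : ∀ i, ‖w i‖ = 1 := fun i => Complex.norm_eq_one_of_pow_eq_one (hw i) hf
  apply Complex.ofReal_injective
  push_cast
  calc _ = ∑ j ∈ Finset.range f, ∑ i, ∑ k,
        (c i : ℂ) * c k * (w i ^ j * (starRingEnd ℂ) (w k ^ j)) := by
        refine Finset.sum_congr rfl fun j _ => ?_
        rw [← Complex.mul_conj', map_sum, Finset.sum_mul_sum]
        refine Finset.sum_congr rfl fun i _ => Finset.sum_congr rfl fun k _ => ?_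
        rw [map_mul, Complex.conj_ofReal]
        ring
    _ = ∑ i, ∑ k, (c i : ℂ) * c k * ∑ j ∈ Finset.range f, w i ^ j * (starRingEnd ℂ) (w k ^ j) := by
        rw [Finset.sum_comm]
        refine Finset.sum_congr rfl fun i _ => ?_
        rw [Finset.sum_comm]
        simp only [Finset.mul_sum]
    _ = _ := by
        simp only [fun i k => sum_pow_mul_conj_pow f (w i) (w k) (hw i) (hw k) (h1 k),
          Finset.mul_sum]
        refine Finset.sum_congr rfl fun i _ => Finset.sum_congr rfl fun k _ => ?_
        split_ifs <;> push_cast <;> ring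

/-- A difference of two sums of three roots of unity, at least one of which does not
have all its terms equal, has quadratic mean at most `√14` over the powers of the terms. -/
theorem sum_norm_sq_le (f : ℕ) (hf : f ≠ 0) (w : Fin 6 → ℂ) (hw : ∀ i, w i ^ f = 1)
    (hne : ¬ ((w 0 = w 1 ∧ w 0 = w 2) ∧ (w 3 = w 4 ∧ w 3 = w 5))) :
    ∑ j ∈ Finset.range f,
      ‖w 0 ^ j + w 1 ^ j + w 2 ^ j - (w 3 ^ j + w 4 ^ j + w 5 ^ j)‖ ^ 2 ≤ 14 * f := by
  have h := sum_norm_sq_eq f hf ![1, 1, 1, -1, -1, -1] w hw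
  have h2 : ∀ j, ∑ i, ((![1, 1, 1, -1, -1, -1] : Fin 6 → ℝ) i : ℂ) * w i ^ j =
      w 0 ^ j + w 1 ^ j + w 2 ^ j - (w 3 ^ j + w 4 ^ j + w 5 ^ j) := by
    intro j
    simp [Fin.sum_univ_succ]
    ring
  simp only [h2] at h
  rw [h, mul_comm]
  refine mul_le_mul_of_nonneg_right ?_ (Nat.cast_nonneg f)
  obtain ⟨D, hD⟩ : ∃ D : Fin 6 → Fin 6 → ℝ, ∀ i k, D i k = if w i = w k then 1 else 0 :=
    ⟨_, fun _ _ => rfl⟩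
  have h0 : ∀ i k, 0 ≤ D i k := fun i k => by rw [hD]; split_ifs <;> norm_num
  have hs : ∀ i k, D i k = D k i := fun i k => by simp only [hD, eq_comm]
  have hle : ∀ i k, D i k ≤ 1 := fun i k => by rw [hD]; split_ifs <;> norm_num
  have hd : ∀ i, D i i = 1 := fun i => by rw [hD, if_pos rfl]
  have htri : ∀ i k l, ¬ (w i = w k ∧ w i = w l) → D i k + D i l + D k l ≤ 1 := by
    intro i k l hn
    simp only [hD]
    split_ifs <;> first | (norm_num; done) | (exfalso; simp_all)
  simp only [← hD]
  have hmain : 2 * (D 0 1 + D 0 2 + D 1 2) + 2 * (D 3 4 + D 3 5 + D 4 5) ≤ 8 := by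
    rcases not_and_or.1 hne with h | h
    · linarith [htri _ _ _ h, hle 3 4, hle 3 5, hle 4 5]
    · linarith [htri _ _ _ h, hle 0 1, hle 0 2, hle 1 2]
  simp [Fin.sum_univ_six, hd]
  linarith [hs 0 1, hs 0 2, hs 1 2, hs 3 4, hs 3 5, hs 4 5, h0 0 3, h0 0 4, h0 0 5, h0 1 3,
    h0 1 4, h0 1 5, h0 2 3, h0 2 4, h0 2 5, h0 3 0, h0 4 0, h0 5 0, h0 3 1, h0 4 1, h0 5 1,
    h0 3 2, h0 4 2, h0 5 2]

/-- The product of the values of a polynomial at the primitive `f`-th roots of unity is bounded in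
terms of the sum of the squares of its values at all `f`-th roots of unity. -/
theorem prod_primitiveRoots_le (f : ℕ) (hf : 0 < f) (ω : ℂ) (hω : IsPrimitiveRoot ω f)
    (G : ℂ → ℂ) (hG : ∑ j ∈ Finset.range f, ‖G (ω ^ j)‖ ^ 2 ≤ 14 * f) :
    ∏ z ∈ primitiveRoots f ℂ, ‖G z‖ ≤ √14 ^ f := by
  have : NeZero f := ⟨hf.ne'⟩
  set P := primitiveRoots f ℂ
  have hcard : P.card ≤ f := by
    rw [Complex.card_primitiveRoots]
    exact Nat.totient_le f
  have hsub : P ⊆ (Finset.range f).image (ω ^ ·) := by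
    intro z hz
    obtain ⟨i, hi, rfl⟩ := hω.eq_pow_of_pow_eq_one ((mem_primitiveRoots hf).1 hz).pow_eq_one
    exact Finset.mem_image_of_mem _ (Finset.mem_range.2 hi)
  have hsum : ∑ z ∈ P, ‖G z‖ ^ 2 ≤ 14 * f := by
    refine le_trans ?_ hG
    rw [← Finset.sum_image (s := Finset.range f) (g := (ω ^ ·)) (f := fun z => ‖G z‖ ^ 2)]
    · exact Finset.sum_le_sum_of_subset_of_nonneg hsub fun _ _ _ => by positivity
    · intro i hi j hj hij
      exact hω.pow_inj (Finset.mem_range.1 hi) (Finset.mem_range.1 hj) hij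
  have hexp : ∏ z ∈ P, (‖G z‖ ^ 2 / 14) ≤ 14 ^ (f - P.card) := by
    calc ∏ z ∈ P, (‖G z‖ ^ 2 / 14) ≤ ∏ z ∈ P, Real.exp (‖G z‖ ^ 2 / 14 - 1) :=
          Finset.prod_le_prod (fun _ _ => by positivity) fun z _ => by
            linarith [Real.add_one_le_exp (‖G z‖ ^ 2 / 14 - 1)]
      _ = Real.exp (∑ z ∈ P, (‖G z‖ ^ 2 / 14 - 1)) := (Real.exp_sum _ _).symm
      _ ≤ Real.exp ((f - P.card : ℕ) : ℝ) := by
          refine Real.exp_le_exp.2 ?_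
          rw [Finset.sum_sub_distrib, ← Finset.sum_div, Nat.cast_sub hcard]
          simp only [Finset.sum_const, nsmul_eq_mul, mul_one]
          linarith
      _ = Real.exp 1 ^ (f - P.card) := by rw [← Real.exp_nat_mul, mul_one]
      _ ≤ 14 ^ (f - P.card) :=
          pow_le_pow_left₀ (Real.exp_pos 1).le (by linarith [Real.exp_one_lt_d9]) _
  rw [Finset.prod_div_distrib, Finset.prod_const, div_le_iff₀ (by positivity), ← pow_add,
    Nat.sub_add_cancel hcard, Finset.prod_pow] at hexp
  refine (sq_le_sq₀ (Finset.prod_nonneg fun _ _ => norm_nonneg _) (by positivity)).1 ?_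
  rwa [← pow_mul, mul_comm f, pow_mul, Real.sq_sqrt (by norm_num)]

/-- A line through `(1, 1)` meets the torus `|x| = |y| = 1` in two further points with distinct
coordinates only if it is the diagonal. -/
theorem eq_of_collinear_of_norm_eq_one {x₂ x₃ y₂ y₃ : ℂ} (hx₂ : ‖x₂‖ = 1) (hx₃ : ‖x₃‖ = 1)
    (hy₂ : ‖y₂‖ = 1) (hy₃ : ‖y₃‖ = 1) (hx₂' : x₂ ≠ 1) (hy₃' : y₃ ≠ 1) (hy : y₂ ≠ y₃)
    (h : x₂ * y₃ + x₃ + y₂ - (x₃ * y₂ + x₂ + y₃) = 0) : x₂ = y₂ := by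
  have h0 : ∀ z : ℂ, ‖z‖ = 1 → z ≠ 0 := fun z hz => by
    rintro rfl
    simp at hz
  have hc := congrArg (starRingEnd ℂ) h
  simp only [map_sub, map_add, map_mul, map_zero, ← Complex.inv_eq_conj hx₂,
    ← Complex.inv_eq_conj hx₃, ← Complex.inv_eq_conj hy₂, ← Complex.inv_eq_conj hy₃] at hc
  have h1 := h0 _ hx₂
  have h2 := h0 _ hx₃
  have h3 := h0 _ hy₂
  have h4 := h0 _ hy₃
  field_simp at hc
  have h5 : (x₂ - 1) * (y₃ - 1) * (x₂ * y₃ - x₃ * y₂) = 0 := by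
    linear_combination x₂ * y₃ * h - hc
  have h6 : x₂ * y₃ - x₃ * y₂ = 0 := by
    rcases mul_eq_zero.1 h5 with h | h
    · rcases mul_eq_zero.1 h with h | h
      · exact absurd (sub_eq_zero.1 h) hx₂'
      · exact absurd (sub_eq_zero.1 h) hy₃'
    · exact h
  have h7 : (x₂ - y₂) * (y₃ - y₂) = 0 := by
    linear_combination (1 - y₂) * h6 + y₂ * h
  rcases mul_eq_zero.1 h7 with h | h
  · exact sub_eq_zero.1 h
  · exact absurd (sub_eq_zero.1 h).symm hy

theorem IsPrimitiveRoot.pow_eq_pow_iff {M : Type*} [CommMonoid M] {f : ℕ} (hf : 0 < f) {h : M}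
    (hh : IsPrimitiveRoot h f) (a b : ℕ) : h ^ a = h ^ b ↔ a ≡ b [MOD f] := by
  have hmod : ∀ n, h ^ n = h ^ (n % f) := fun n => by
    rw [hh.eq_orderOf, pow_mod_orderOf]
  rw [hmod a, hmod b]
  exact ⟨fun H => hh.pow_inj (Nat.mod_lt _ hf) (Nat.mod_lt _ hf) H, fun H => congrArg _ H⟩

/-- If `14 ^ (f / 2) < p ^ ord_f(p)`, then a line over a finite field of characteristic `p` meets
the set of pairs of `f`-th roots of unity in `(1, 1)` and two further points with distinct
coordinates only if it is the diagonal. -/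
theorem eq_of_collinear_of_pow_eq_one {F : Type*} [Field F] [Finite F] (p s f : ℕ)
    (hp : p.Prime) (hq : Nat.card F = p ^ s) (hf : 0 < f) (h : F) (hh : IsPrimitiveRoot h f)
    (hbound : √14 ^ f < (p : ℝ) ^ orderOf (p : ZMod f)) {x₂ x₃ y₂ y₃ : F}
    (hx₂ : x₂ ^ f = 1) (hx₃ : x₃ ^ f = 1) (hy₂ : y₂ ^ f = 1) (hy₃ : y₃ ^ f = 1)
    (hx₂' : x₂ ≠ 1) (hy₃' : y₃ ≠ 1) (hy : y₂ ≠ y₃)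
    (heq : x₂ * y₃ + x₃ + y₂ - (x₃ * y₂ + x₂ + y₃) = 0) : x₂ = y₂ := by
  have : NeZero f := ⟨hf.ne'⟩
  have hdeg : ¬ ((x₂ * y₃ = x₃ ∧ x₂ * y₃ = y₂) ∧ (x₃ * y₂ = x₂ ∧ x₃ * y₂ = y₃)) := by
    rintro ⟨⟨h1, h2⟩, h3, h4⟩
    have e1 : y₃ = x₂ := h4.symm.trans h3
    have e2 : y₂ = x₃ := h2.symm.trans h1
    subst e1 e2
    have h30 : (3 : F) = 0 := by
      have : (3 : F) * (y₂ - y₃) = 0 := by linear_combination heq - h1 + h3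
      exact (mul_eq_zero.1 this).resolve_right (sub_ne_zero.2 hy)
    have hne : y₃ ≠ 0 := by
      rintro rfl
      simp [hf.ne'] at hy₃
    have h5 : y₃ * (y₃ - 1) ^ 3 = 0 := by
      linear_combination (y₃ * y₃ + y₂) * h1 + h3 + (-y₃ ^ 3 + y₃ ^ 2) * h30
    rcases mul_eq_zero.1 h5 with h | h
    · exact hne h
    · exact hx₂' (sub_eq_zero.1 (pow_eq_zero_iff (by norm_num) |>.1 h))
  obtain ⟨a, -, rfl⟩ := hh.eq_pow_of_pow_eq_one hx₂
  obtain ⟨b, -, rfl⟩ := hh.eq_pow_of_pow_eq_one hy₂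
  obtain ⟨c, -, rfl⟩ := hh.eq_pow_of_pow_eq_one hx₃
  obtain ⟨d, -, rfl⟩ := hh.eq_pow_of_pow_eq_one hy₃
  have hω := Complex.isPrimitiveRoot_exp f hf.ne'
  set ω := Complex.exp (2 * Real.pi * Complex.I / f)
  have hiff (m n : ℕ) : h ^ m = h ^ n ↔ ω ^ m = ω ^ n := by
    rw [hh.pow_eq_pow_iff hf, hω.pow_eq_pow_iff hf]
  have hpow (n : ℕ) : (ω ^ n) ^ f = 1 := by
    rw [← pow_mul, mul_comm, pow_mul, hω.pow_eq_one, one_pow]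
  have hnorm (n : ℕ) : ‖ω ^ n‖ = 1 := Complex.norm_eq_one_of_pow_eq_one (hpow n) hf.ne'
  let T : ℤ[X] := X ^ (a + d) + X ^ c + X ^ b - (X ^ (c + b) + X ^ a + X ^ d)
  have hT : aeval h T = 0 := by
    simp only [T, map_sub, map_add, map_mul, map_pow, aeval_X, pow_add]
    exact heq
  by_cases hTω : aeval ω T = 0
  · rw [hiff]
    refine eq_of_collinear_of_norm_eq_one (hnorm a) (hnorm c) (hnorm b) (hnorm d)
      (fun H => hx₂' ?_) (fun H => hy₃' ?_) (fun H => hy ((hiff _ _).2 H)) ?_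
    · simpa using (hiff a 0).2 (by simpa using H)
    · simpa using (hiff d 0).2 (by simpa using H)
    · simpa only [T, map_sub, map_add, map_mul, map_pow, aeval_X, pow_add] using hTω
  · exfalso
    have : IsCyclotomicExtension {f} ℚ (CyclotomicField f ℚ) :=
      CyclotomicField.isCyclotomicExtension f ℚ
    have h1 := pow_orderOf_le_prod_primitiveRoots (CyclotomicField f ℚ) p s f hp hq hf h hh
      T hT ω hω hTω
    refine absurd (h1.trans (prod_primitiveRoots_le f hf ω hω (fun z => aeval z T) ?_))
      (not_le.2 hbound)
    have h2 := sum_norm_sq_le f hf.ne' ![ω ^ (a + d), ω ^ c, ω ^ b, ω ^ (c + b), ω ^ a, ω ^ d]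
      (by intro i; fin_cases i <;> exact hpow _)
      (by
        intro H
        apply hdeg
        simp only [← pow_add, hiff]
        exact H)
    refine le_of_eq_of_le (Finset.sum_congr rfl fun j _ => ?_) h2
    simp only [T, map_sub, map_add, map_pow, aeval_X]
    simp only [pow_right_comm ω j]
    rfl

/-- let `q = p^s` with `q - 1 = ef` (`e, f > 1`), `g` a generator of `F_q^*`,
and suppose `f < log_{√14}(p^(ord_f(p)))`. Let `S' = {1, g^e, …, g^((f-1)e)}` be the
subgroup of `F_q^*` of order `f`. Then `|δS' ∩ (S' + γ)| ≤ 2` for every `δ ∈ F_q` and every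
`γ ≠ 0`. -/
theorem subgroup_small_intersections_with_affine_images
    {F : Type*} [Field F] [Fintype F] (p s e f : ℕ) (hp : p.Prime) (hs : 1 ≤ s)
    (hq : Fintype.card F = p ^ s)
    (he : 1 < e) (hf : 1 < f) (hef : p ^ s - 1 = e * f)
    (g : F) (hg : orderOf g = p ^ s - 1)
    (hflog : (f : ℝ) < Real.logb (Real.sqrt 14) ((p : ℝ) ^ orderOf (p : ZMod f)))
    (S' : Set F) (hS' : S' = {x | ∃ i : ℕ, i < f ∧ x = g ^ (i * e)}) :
    ∀ δ γ : F, γ ≠ 0 → ((δ • S') ∩ ((fun x => x + γ) '' S')).ncard ≤ 2 := by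
  have hq' : Nat.card F = p ^ s := by rw [Nat.card_eq_fintype_card, hq]
  have hf0 : 0 < f := by omega
  have hh : IsPrimitiveRoot (g ^ e) f := by
    have h1 := IsPrimitiveRoot.orderOf g
    rw [hg, hef] at h1
    exact h1.pow (Nat.mul_pos (by omega) hf0) rfl
  have hbound : √14 ^ f < (p : ℝ) ^ orderOf (p : ZMod f) := by
    have h1 : (1 : ℝ) < √14 := by
      rw [Real.lt_sqrt (by norm_num)]
      norm_num
    rw [← Real.rpow_natCast]
    exact (Real.lt_logb_iff_rpow_lt h1 (pow_pos (by exact_mod_cast hp.pos) _)).1 hflog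
  have hS : ∀ x ∈ S', x ^ f = 1 := by
    rw [hS']
    rintro x ⟨i, -, rfl⟩
    rw [mul_comm, pow_mul, ← pow_mul, mul_comm, pow_mul, hh.pow_eq_one, one_pow]
  have hS0 : ∀ x ∈ S', x ≠ 0 := by
    rintro x hx rfl
    simpa [hf0.ne'] using hS 0 hx
  have hdiv : ∀ x ∈ S', ∀ y ∈ S', (y / x) ^ f = 1 := fun x hx y hy => by
    rw [div_pow, hS x hx, hS y hy, div_one]
  intro δ γ hγ
  by_contra! hcon
  obtain ⟨t₁, t₂, t₃, ⟨⟨x₁, hx₁, e₁⟩, ⟨y₁, hy₁, d₁⟩⟩, ⟨⟨x₂, hx₂, e₂⟩, ⟨y₂, hy₂, d₂⟩⟩,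
    ⟨⟨x₃, hx₃, e₃⟩, ⟨y₃, hy₃, d₃⟩⟩, h12, h13, h23⟩ := (Set.two_lt_ncard_iff (Set.toFinite _)).1 hcon
  simp only [smul_eq_mul] at e₁ e₂ e₃ d₁ d₂ d₃
  have hx0 := hS0 x₁ hx₁
  have hy0 := hS0 y₁ hy₁
  have hx21 : x₂ / x₁ ≠ 1 := fun H => h12 (by
    rw [← e₁, ← e₂, (div_eq_one_iff_eq hx0).1 H])
  have key : x₂ / x₁ = y₂ / y₁ := by
    refine eq_of_collinear_of_pow_eq_one p s f hp hq' hf0 (g ^ e) hh hbound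
      (x₃ := x₃ / x₁) (y₃ := y₃ / y₁) (hdiv _ hx₁ _ hx₂) (hdiv _ hx₁ _ hx₃) (hdiv _ hy₁ _ hy₂)
      (hdiv _ hy₁ _ hy₃) hx21 (fun H => h13 ?_) (fun H => h23 ?_) ?_
    · rw [← d₁, ← d₃, (div_eq_one_iff_eq hy0).1 H]
    · rw [← d₂, ← d₃, (div_left_inj' hy0).1 H]
    · have h2 : δ * (x₂ - x₁) = y₂ - y₁ := by linear_combination e₂ - e₁ - d₂ + d₁
      have h3 : δ * (x₃ - x₁) = y₃ - y₁ := by linear_combination e₃ - e₁ - d₃ + d₁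
      field_simp
      linear_combination (x₃ - x₁) * h2 - (x₂ - x₁) * h3
  have hfin : (δ * x₁ - y₁) * (x₂ / x₁ - 1) = 0 := by
    have h2 : δ * (x₂ - x₁) = y₂ - y₁ := by linear_combination e₂ - e₁ - d₂ + d₁
    have hx : x₁ * (x₂ / x₁) = x₂ := mul_div_cancel₀ _ hx0
    have hy : y₁ * (y₂ / y₁) = y₂ := mul_div_cancel₀ _ hy0
    linear_combination δ * hx + h2 - hy - y₁ * key
  rcases mul_eq_zero.1 hfin with H | H
  · exact hγ (by linear_combination H - e₁ + d₁)
  · exact hx21 (sub_eq_zero.1 H)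
end

section
/- Let q be a prime power with q − 1 = ef for integers e, f > 1, and let g be a generator of F_q^*. Let T = {a_1, …, a_n} be a subset of ℤ_f (residues modulo f) such that every nonzero element of ℤ_f appears at most twice in the multiset T − T = {x − y : x, y ∈ T}. Define S = {g^{a_1 e}, …, g^{a_n e}} ⊆ F_q. Then |S| = n, and for every δ ∈ F_q with δ ≠ 1, one has |δS ∩ S| ≤ 2, where δS = {δs : s ∈ S}. -/
open Pointwise

theorem pow_val_add {M : Type*} [Monoid M] {f : ℕ} [NeZero f] {h : M} (hh : orderOf h = f)
    (a b : ZMod f) : h ^ (a + b).val = h ^ a.val * h ^ b.val := by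
  have hmod := pow_mod_orderOf h (a.val + b.val)
  rw [hh] at hmod
  rw [ZMod.val_add, hmod, pow_add]

theorem pow_val_injective {M : Type*} [LeftCancelMonoid M] {f : ℕ} [NeZero f] {h : M}
    (hh : orderOf h = f) : Function.Injective fun a : ZMod f => h ^ a.val := fun a b hab =>
  ZMod.val_injective f <|
    pow_injOn_Iio_orderOf (by simpa [hh] using a.val_lt) (by simpa [hh] using b.val_lt) hab

theorem ncard_smul_inter_le_two {F : Type*} [Field F] {A : Type*} [AddCommGroup A]
    [DecidableEq A] (φ : A → F) (hφ : Function.Injective φ) (hφ0 : ∀ a, φ a ≠ 0)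
    (hadd : ∀ a b, φ (a + b) = φ a * φ b) (T : Finset A)
    (hT : ∀ z : A, z ≠ 0 → ((T ×ˢ T).filter fun xy => xy.1 - xy.2 = z).card ≤ 2)
    {δ : F} (hδ : δ ≠ 1) : ((δ • (φ '' (T : Set A))) ∩ φ '' (T : Set A)).ncard ≤ 2 := by
  classical
  rcases Set.eq_empty_or_nonempty ((δ • (φ '' (T : Set A))) ∩ φ '' (T : Set A)) with hE | hE
  · simp [hE]
  obtain ⟨_, ⟨_, ⟨b₀, -, rfl⟩, h₀⟩, ⟨a₀, -, rfl⟩⟩ := hE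
  have hδφ : δ = φ (a₀ - b₀) := by
    apply mul_right_cancel₀ (hφ0 b₀)
    rw [← hadd, sub_add_cancel]
    exact h₀
  have hz : a₀ - b₀ ≠ 0 := by
    intro hz
    have h1 := hadd 0 0
    rw [add_zero] at h1
    rw [hz] at hδφ
    exact hδ (hδφ.trans ((left_eq_mul₀ (hφ0 0)).mp h1))
  have hsub : (δ • (φ '' (T : Set A))) ∩ φ '' (T : Set A) ⊆
      (((T ×ˢ T).filter fun xy => xy.1 - xy.2 = a₀ - b₀).image fun xy => φ xy.1 : Finset F) := by
    rintro _ ⟨⟨_, ⟨b, hb, rfl⟩, h⟩, ⟨a, ha, rfl⟩⟩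
    have hab : a₀ - b₀ + b = a := hφ (by rw [hadd, ← hδφ]; exact h)
    simp only [Finset.coe_image, Set.mem_image, Finset.mem_coe, Finset.mem_filter,
      Finset.mem_product]
    exact ⟨(a, b), ⟨⟨ha, hb⟩, by simp [← hab]⟩, rfl⟩
  calc _ ≤ _ := Set.ncard_le_ncard hsub (Finset.finite_toSet _)
    _ = _ := Set.ncard_coe_finset _
    _ ≤ _ := Finset.card_image_le
    _ ≤ 2 := hT _ hz

/-- let `q` be a prime power with `q - 1 = ef` (`e, f > 1`) and `g` a
generator of `F_q^*`. If `T ⊆ ℤ_f` is such that every nonzero element of `ℤ_f` appears at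
most twice in the multiset `T - T`, then `S = {g^(ae) : a ∈ T}` has `|S| = |T|` and
`|δS ∩ S| ≤ 2` for every `δ ≠ 1`. -/
theorem power_image_of_difference_set_small_self_intersections
    {F : Type*} [Field F] [Fintype F] (p s e f : ℕ) (hp : p.Prime) (hs : 1 ≤ s)
    (hq : Fintype.card F = p ^ s)
    (he : 1 < e) (hf : 1 < f) (hef : p ^ s - 1 = e * f)
    (g : F) (hg : orderOf g = p ^ s - 1)
    (T : Finset (ZMod f))
    (hT : ∀ z : ZMod f, z ≠ 0 →
      ((T ×ˢ T).filter fun xy => xy.1 - xy.2 = z).card ≤ 2)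
    (S : Set F) (hS : S = (fun a : ZMod f => g ^ (a.val * e)) '' (T : Set (ZMod f))) :
    S.ncard = T.card ∧ ∀ δ : F, δ ≠ 1 → ((δ • S) ∩ S).ncard ≤ 2 := by
  have : NeZero f := ⟨by omega⟩
  have hg0 : g ≠ 0 := by
    rintro rfl
    have : 0 < e * f := by positivity
    rw [orderOf_zero] at hg
    omega
  have hh : orderOf (Units.mk0 g hg0 ^ e) = f := by
    have hu : orderOf (Units.mk0 g hg0) = e * f := by
      rw [← orderOf_units, Units.val_mk0, hg, hef]
    rw [orderOf_pow_of_dvd (by omega) (hu ▸ dvd_mul_right e f), hu,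
      Nat.mul_div_cancel_left f (by omega)]
  have hφ : (fun a : ZMod f => g ^ (a.val * e)) =
      fun a => (((Units.mk0 g hg0 ^ e) ^ a.val : Fˣ) : F) := by
    funext a
    simp [← pow_mul, mul_comm]
  have hinj : Function.Injective fun a : ZMod f => g ^ (a.val * e) := by
    rw [hφ]
    exact Units.val_injective.comp (pow_val_injective hh)
  subst hS
  refine ⟨by rw [Set.ncard_image_of_injective _ hinj, Set.ncard_coe_finset], fun δ hδ => ?_⟩
  refine ncard_smul_inter_le_two _ hinj (fun a => pow_ne_zero _ hg0) (fun a b => ?_) T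
    (fun z hz => ?_) hδ
  · have hab := congrArg Units.val (pow_val_add hh a b)
    rw [Units.val_mul] at hab
    have h := congrFun hφ
    rw [h, h, h, hab]
  · convert hT z hz
end
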